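/- arXiv:1504.05931 — 3 statements merged into one kernel-verified Lean document; each statement's English description precedes it below -/
import Mathlib

section
/- Consider the multi-user coded caching model with L levels, N_i ∈ ℕ+ files and U_i ∈ ℕ+ users per cache for each level i, and K ∈ ℕ+ caches. Let M ≥ 0 and let m_1, …, m_L be reals with m_i ≥ 0, 0 ≤ m_i ≤ N_i for each i, and Σ_i m_i ≤ M. Then the pair (Σ_{i=1}^{L} R^SL(m_i, K, N_i, U_i), M) is achievable, i.e., memory-sharing achieves the sum of the single-level rates: R*(M) ≤ Σ_{i=1}^{L} R^SL(m_i, K, N_i, U_i). -/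
/-- A library: each level `i` has `N i` files, and each file is an arbitrary
element of `{0,1}^F`. -/
def MULibrary (L : ℕ) (N : Fin L → ℕ+) (F : ℕ) : Type :=
  (i : Fin L) → Fin (N i) → Fin F → Bool

/-- A demand vector of the multi-user setup: each of the `U i` users of level `i`
attached to cache `k` demands one file index of level `i`. -/
def MUDemand (L : ℕ) (N U : Fin L → ℕ+) (K : ℕ+) : Type :=
  (i : Fin L) → Fin K → Fin (U i) → Fin (N i)

/-- The pair `(R, M)` is achievable in the multi-user multi-level coded caching model
with `L` levels, `N i` files and `U i` users per cache for level `i`, and `K` caches: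
`R, M ≥ 0` and, for every `ε > 0`, there are a file size `F` and a scheme consisting of
placement maps `Z k` into a set of cardinality at most `2^(M·F)`, encoding maps `X d`
into a set of cardinality at most `2^((R+ε)·F)`, and decoding maps, such that every
user correctly recovers its demanded file for every library and every demand vector. -/
def MUAchievable (L : ℕ) (N U : Fin L → ℕ+) (K : ℕ+) (R M : ℝ) : Prop :=
  0 ≤ R ∧ 0 ≤ M ∧
  ∀ ε : ℝ, 0 < ε →
    ∃ (F : ℕ+) (zsize xsize : ℕ)
      (Z : Fin K → MULibrary L N F → Fin zsize)
      (X : MUDemand L N U K → MULibrary L N F → Fin xsize)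
      (dec : (i : Fin L) → Fin K → Fin (U i) → MUDemand L N U K →
        Fin xsize → Fin zsize → (Fin F → Bool)),
      (zsize : ℝ) ≤ (2 : ℝ) ^ (M * (F : ℝ)) ∧
      (xsize : ℝ) ≤ (2 : ℝ) ^ ((R + ε) * (F : ℝ)) ∧
      ∀ (w : MULibrary L N F) (d : MUDemand L N U K)
        (i : Fin L) (k : Fin K) (u : Fin (U i)),
        dec i k u d (X d w) (Z k w) = w i (d i k u)

/-- `R*(M)`: the optimal rate of the multi-user setup,
i.e. the infimum of the rates `R` such that `(R, M)` is achievable. -/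
noncomputable def RstarMU (L : ℕ) (N U : Fin L → ℕ+) (K : ℕ+) (M : ℝ) : ℝ :=
  sInf {R | MUAchievable L N U K R M}

/-- The single-level achievable rate
`R^SL(m, K, N, U) = U · min{N/m, K} · (1 − m/N)` for `0 < m ≤ N`, and
`R^SL(0, K, N, U) = U · K`. -/
noncomputable def RSL (m : ℝ) (K : ℕ+) (N U : ℝ) : ℝ :=
  if m = 0 then U * (K : ℝ) else U * min (N / m) (K : ℝ) * (1 - m / N)

namespace MemShare

abbrev FileIdx (K : ℕ) (c : ℕ → ℕ) : Type := (T : Finset (Fin K)) × Fin (c T.card)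
abbrev CacheIdx (K : ℕ) (c : ℕ → ℕ) (k : Fin K) : Type :=
  (T : {T : Finset (Fin K) // k ∈ T}) × Fin (c T.1.card)
def sh (c : ℕ → ℕ) : ℕ → ℕ
  | 0 => 0
  | j + 1 => c j
abbrev TransIdx (K : ℕ) (c : ℕ → ℕ) : Type := (S : Finset (Fin K)) × Fin (sh c S.card)

def ext {K : ℕ} {c : ℕ → ℕ} (f : FileIdx K c → ZMod 2) (T : Finset (Fin K)) (p : ℕ) : ZMod 2 :=
  if h : p < c T.card then f ⟨T, ⟨p, h⟩⟩ else 0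

def extC {K : ℕ} {c : ℕ → ℕ} {k : Fin K} (f : CacheIdx K c k → ZMod 2)
    (T : Finset (Fin K)) (p : ℕ) : ZMod 2 :=
  if h : k ∈ T ∧ p < c T.card then f ⟨⟨T, h.1⟩, ⟨p, h.2⟩⟩ else 0

def extT {K : ℕ} {c : ℕ → ℕ} (f : TransIdx K c → ZMod 2)
    (T : Finset (Fin K)) (p : ℕ) : ZMod 2 :=
  if h : p < sh c T.card then f ⟨T, ⟨p, h⟩⟩ else 0

def cache {K : ℕ} {c : ℕ → ℕ} {n : ℕ} (k : Fin K) (w : Fin n → FileIdx K c → ZMod 2) :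
    Fin n → CacheIdx K c k → ZMod 2 := fun a q => w a ⟨q.1.1, q.2⟩

def enc {K : ℕ} {c : ℕ → ℕ} {n : ℕ} (d : Fin K → Fin n) (w : Fin n → FileIdx K c → ZMod 2) :
    TransIdx K c → ZMod 2 := fun q => ∑ j ∈ q.1, ext (w (d j)) (q.1.erase j) q.2

def decd {K : ℕ} {c : ℕ → ℕ} {n : ℕ} (d : Fin K → Fin n) (k : Fin K)
    (x : TransIdx K c → ZMod 2) (z : Fin n → CacheIdx K c k → ZMod 2) : FileIdx K c → ZMod 2 :=
  fun q => if k ∈ q.1 then extC (z (d k)) q.1 q.2 else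
    extT x (insert k q.1) q.2 - ∑ j ∈ q.1, extC (z (d j)) ((insert k q.1).erase j) q.2

lemma extC_cache {K : ℕ} {c : ℕ → ℕ} {n : ℕ} (k : Fin K) (w : Fin n → FileIdx K c → ZMod 2)
    (a : Fin n) (T : Finset (Fin K)) (hk : k ∈ T) (p : ℕ) :
    extC (cache k w a) T p = ext (w a) T p := by
  unfold extC ext cache
  by_cases h : p < c T.card
  · simp [h, hk]
  · simp [h]

lemma decd_enc {K : ℕ} {c : ℕ → ℕ} {n : ℕ} (d : Fin K → Fin n) (k : Fin K)
    (w : Fin n → FileIdx K c → ZMod 2) :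
    decd d k (enc d w) (cache k w) = w (d k) := by
  funext q
  obtain ⟨T, p⟩ := q
  have hx : ext (w (d k)) T p = w (d k) ⟨T, p⟩ := by simp [ext]
  unfold decd
  by_cases hk : k ∈ T
  · simp only [hk, if_true]
    rw [extC_cache _ _ _ _ hk, hx]
  · simp only [hk, if_false]
    have hp : (p : ℕ) < sh c (insert k T).card := by
      rw [Finset.card_insert_of_notMem hk]; exact p.2
    have h1 : extT (enc d w) (insert k T) p
        = ∑ j ∈ insert k T, ext (w (d j)) ((insert k T).erase j) p := by
      unfold extT
      rw [dif_pos hp]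
      rfl
    rw [h1, Finset.sum_insert hk, Finset.erase_insert hk, hx]
    have h2 : ∑ j ∈ T, extC (cache k w (d j)) ((insert k T).erase j) p
        = ∑ j ∈ T, ext (w (d j)) ((insert k T).erase j) p := by
      refine Finset.sum_congr rfl fun j hj => extC_cache _ _ _ _ ?_ _
      refine Finset.mem_erase.2 ⟨?_, Finset.mem_insert_self _ _⟩
      rintro rfl; exact hk hj
    rw [h2]; ring

lemma card_file (K : ℕ) (c : ℕ → ℕ) :
    Fintype.card (FileIdx K c) = ∑ j ∈ Finset.range (K + 1), K.choose j * c j := by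
  rw [Fintype.card_sigma]
  simp only [Fintype.card_fin]
  have := Finset.sum_powerset_apply_card c (x := (Finset.univ : Finset (Fin K)))
  simpa using this

lemma card_trans (K : ℕ) (c : ℕ → ℕ) :
    Fintype.card (TransIdx K c) = ∑ j ∈ Finset.range (K + 1), K.choose (j + 1) * c j := by
  have := card_file K (sh c)
  rw [show Fintype.card (TransIdx K c) = _ from this, Finset.sum_range_succ',
    Finset.sum_range_succ]
  simp [sh]

lemma card_cache (K : ℕ) (c : ℕ → ℕ) (k : Fin K) :
    Fintype.card (CacheIdx K c k) = ∑ j ∈ Finset.range K, (K - 1).choose j * c (j + 1) := by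
  rw [Fintype.card_sigma]
  simp only [Fintype.card_fin]
  have h1 : ∑ T : {T : Finset (Fin K) // k ∈ T}, c T.1.card
      = ∑ T : Finset (Fin K), if k ∈ T then c T.card else 0 := by
    rw [← Finset.sum_filter]
    exact (Finset.sum_subtype (p := fun T : Finset (Fin K) => k ∈ T)
      (Finset.univ.filter fun T => k ∈ T) (by simp) (fun T => c T.card)).symm
  rw [h1, ← Finset.powerset_univ, ← Finset.insert_erase (Finset.mem_univ k),
    Finset.sum_powerset_insert (Finset.notMem_erase _ _)]
  have hK : 0 < K := k.pos
  have h2 : ∀ T ∈ (Finset.univ.erase k).powerset, k ∉ T := by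
    intro T hT hk
    exact Finset.notMem_erase _ _ (Finset.mem_powerset.1 hT hk)
  rw [Finset.sum_eq_zero (fun T hT => if_neg (h2 T hT)), zero_add]
  have h3 : ∑ T ∈ (Finset.univ.erase k).powerset,
      (if k ∈ insert k T then c (insert k T).card else 0)
      = ∑ T ∈ (Finset.univ.erase k).powerset, c (T.card + 1) := by
    refine Finset.sum_congr rfl fun T hT => ?_
    rw [if_pos (Finset.mem_insert_self _ _), Finset.card_insert_of_notMem (h2 T hT)]
  rw [h3]
  have := Finset.sum_powerset_apply_card (fun j => c (j + 1)) (x := Finset.univ.erase k)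
  rw [this, Finset.card_erase_of_mem (Finset.mem_univ k), Finset.card_univ, Fintype.card_fin,
    Nat.sub_add_cancel hK]
  simp

lemma assemble (L : ℕ) (N U : Fin L → ℕ+) (K : ℕ+) (F : ℕ) (c : Fin L → ℕ → ℕ)
    (hF : ∀ i, ∑ j ∈ Finset.range ((K : ℕ) + 1), (K : ℕ).choose j * c i j = F) :
    ∃ (Z : Fin K → MULibrary L N F →
        Fin (2 ^ ∑ i, (N i : ℕ) * ∑ j ∈ Finset.range (K : ℕ), ((K : ℕ) - 1).choose j * c i (j + 1)))
      (X : MUDemand L N U K → MULibrary L N F →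
        Fin (2 ^ ∑ i, (U i : ℕ) * ∑ j ∈ Finset.range ((K : ℕ) + 1), (K : ℕ).choose (j + 1) * c i j))
      (dec : (i : Fin L) → Fin K → Fin (U i) → MUDemand L N U K → Fin _ → Fin _ → (Fin F → Bool)),
      ∀ (w : MULibrary L N F) (d : MUDemand L N U K)
        (i : Fin L) (k : Fin K) (u : Fin (U i)),
        dec i k u d (X d w) (Z k w) = w i (d i k u) := by
  classical
  let e : Bool ≃ ZMod 2 := Fintype.equivOfCardEq (by simp)
  have f : ∀ i, Fin F ≃ FileIdx K (c i) := fun i =>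
    Fintype.equivOfCardEq (by rw [card_file, hF, Fintype.card_fin])
  have ez : ∀ k, ((i : Fin L) → Fin (N i) → CacheIdx K (c i) k → ZMod 2) ≃
      Fin (2 ^ ∑ i, (N i : ℕ) * ∑ j ∈ Finset.range (K : ℕ), ((K : ℕ) - 1).choose j * c i (j + 1)) :=
    fun k => Fintype.equivFinOfCardEq (by
      rw [Fintype.card_pi, ← Finset.prod_pow_eq_pow_sum]
      refine Finset.prod_congr rfl fun i _ => ?_
      rw [Fintype.card_fun, Fintype.card_fun, card_cache, ZMod.card, Fintype.card_fin, ← pow_mul,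
        mul_comm])
  have ex : ((i : Fin L) → Fin (U i) → TransIdx K (c i) → ZMod 2) ≃
      Fin (2 ^ ∑ i, (U i : ℕ) * ∑ j ∈ Finset.range ((K : ℕ) + 1), (K : ℕ).choose (j + 1) * c i j) :=
    Fintype.equivFinOfCardEq (by
      rw [Fintype.card_pi, ← Finset.prod_pow_eq_pow_sum]
      refine Finset.prod_congr rfl fun i _ => ?_
      rw [Fintype.card_fun, Fintype.card_fun, card_trans, ZMod.card, Fintype.card_fin, ← pow_mul,
        mul_comm])
  let cv : MULibrary L N F → (i : Fin L) → Fin (N i) → FileIdx K (c i) → ZMod 2 :=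
    fun w i a q => e (w i a ((f i).symm q))
  refine ⟨fun k w => ez k fun i => cache k (cv w i),
    fun d w => ex fun i u => enc (fun k => d i k u) (cv w i),
    fun i k u d x z => fun b =>
      e.symm (decd (fun k => d i k u) k (ex.symm x i u) ((ez k).symm z i) (f i b)), ?_⟩
  intro w d i k u
  funext b
  simp only [Equiv.symm_apply_apply]
  rw [decd_enc]
  simp [cv]

lemma split_pt (K : ℕ) (hK : 0 < K) (x : ℝ) (h0 : 0 ≤ x) (h1 : x ≤ K) :
    ∃ (n : ℕ) (s : ℝ), n < K ∧ 0 ≤ s ∧ s ≤ 1 ∧ x = n + s := by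
  rcases h1.lt_or_eq with h | h
  · refine ⟨⌊x⌋₊, x - ⌊x⌋₊, (Nat.floor_lt h0).2 h, ?_, ?_, by ring⟩
    · linarith [Nat.floor_le h0]
    · linarith [Nat.lt_floor_add_one x]
  · refine ⟨K - 1, 1, by omega, by norm_num, le_rfl, ?_⟩
    rw [h, Nat.cast_sub hK]; simp

/-- the rate inequality -/
lemma rate_ineq (K n : ℕ) (s x : ℝ) (hn : n < K) (hs0 : 0 ≤ s) (hs1 : s ≤ 1) (hx : x = n + s) :
    (1 - s) * ((K - n : ℝ) / (n + 1)) + s * ((K - (n + 1) : ℝ) / (n + 2)) ≤ K - x ∧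
    (0 < x → (1 - s) * ((K - n : ℝ) / (n + 1)) + s * ((K - (n + 1) : ℝ) / (n + 2)) ≤ K / x - 1) := by
  have hn' : (n : ℝ) + 1 ≤ K := by exact_mod_cast hn
  have h0 : (0 : ℝ) ≤ n := Nat.cast_nonneg n
  constructor
  · have a1 : (K - n : ℝ) / (n + 1) ≤ K - n := div_le_self (by linarith) (by linarith)
    have a2 : (K - (n + 1) : ℝ) / (n + 2) ≤ K - (n + 1) := div_le_self (by linarith) (by linarith)
    nlinarith [mul_le_mul_of_nonneg_left a1 (sub_nonneg.2 hs1), mul_le_mul_of_nonneg_left a2 hs0]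
  · intro hxp
    have e1 : (1 - s) * ((K - n : ℝ) / (n + 1)) + s * ((K - (n + 1) : ℝ) / (n + 2))
        = (K + 1) * (n + 2 - s) / ((n + 1) * (n + 2)) - 1 := by
      field_simp; ring
    rw [e1]
    have : (K + 1 : ℝ) * (n + 2 - s) / ((n + 1) * (n + 2)) ≤ K / x := by
      rw [div_le_div_iff₀ (by positivity) hxp, hx]
      nlinarith [mul_le_mul_of_nonneg_right hn' (by nlinarith [sq_nonneg (1 - s)] : (0:ℝ) ≤ n + 1 + (1 - s)^2),
        sq_nonneg (1 - s)]
    linarith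

lemma weights (K n : ℕ) (s : ℝ) (hn : n < K) (hs0 : 0 ≤ s) (hs1 : s ≤ 1) :
    ∃ α : ℕ → ℝ, (∀ j, 0 ≤ α j) ∧
      ∑ j ∈ Finset.range (K + 1), (K.choose j : ℝ) * α j = 1 ∧
      (K : ℝ) * ∑ j ∈ Finset.range K, ((K - 1).choose j : ℝ) * α (j + 1) = n + s ∧
      ∑ j ∈ Finset.range (K + 1), (K.choose (j + 1) : ℝ) * α j
        = (1 - s) * ((K - n : ℝ) / (n + 1)) + s * ((K - (n + 1) : ℝ) / (n + 2)) := by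
  have c1 : (0 : ℝ) < K.choose n := by exact_mod_cast Nat.choose_pos hn.le
  have c2 : (0 : ℝ) < K.choose (n + 1) := by exact_mod_cast Nat.choose_pos hn
  let α : ℕ → ℝ := fun t => (if t = n then (1 - s) / K.choose n else 0) +
    (if t = n + 1 then s / K.choose (n + 1) else 0)
  have key : ∀ φ : ℕ → ℝ, ∑ j ∈ Finset.range (K + 1), φ j * α j
      = φ n * ((1 - s) / K.choose n) + φ (n + 1) * (s / K.choose (n + 1)) := by
    intro φ
    simp only [α, mul_add, Finset.sum_add_distrib, mul_ite, mul_zero, Finset.sum_ite_eq',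
      Finset.mem_range]
    rw [if_pos (by omega), if_pos (by omega)]
  have ch : ∀ j, j ≤ K → (K.choose (j + 1) : ℝ) = K.choose j * ((K - j) / (j + 1)) := by
    intro j hj
    have := Nat.choose_succ_right_eq K j
    have h2 : (K.choose (j + 1) : ℝ) * (j + 1) = K.choose j * (K - j) := by
      rw [← Nat.cast_sub hj]; exact_mod_cast this
    field_simp
    linarith
  refine ⟨α, ?_, ?_, ?_, ?_⟩
  · intro j
    have := sub_nonneg.2 hs1
    simp only [α]
    positivity
  · rw [key]; field_simp; ring
  · have : (K : ℝ) * ∑ j ∈ Finset.range K, ((K - 1).choose j : ℝ) * α (j + 1)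
        = ∑ j ∈ Finset.range (K + 1), ((j : ℝ) * K.choose j) * α j := by
      rw [Finset.sum_range_succ', Finset.mul_sum]
      simp only [Nat.cast_zero, zero_mul, add_zero]
      refine Finset.sum_congr rfl fun j _ => ?_
      have h := Nat.add_one_mul_choose_eq (K - 1) j
      rw [Nat.sub_add_cancel (by omega : 1 ≤ K)] at h
      have h2 : (K : ℝ) * (K - 1).choose j = K.choose (j + 1) * ((j + 1 : ℕ) : ℝ) := by
        exact_mod_cast h
      rw [← mul_assoc, h2]; ring
    rw [this, key]
    push_cast
    field_simp
    ring
  · rw [key]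
    have p1 : (K.choose (n + 1) : ℝ) * ((1 - s) / K.choose n)
        = (1 - s) * ((K - n : ℝ) / (n + 1)) := by
      rw [ch n hn.le]; field_simp
    have p2 : (K.choose (n + 1 + 1) : ℝ) * (s / K.choose (n + 1))
        = s * ((K - (n + 1) : ℝ) / (n + 2)) := by
      have e1 : ((n + 1 : ℕ) : ℝ) + 1 = n + 2 := by push_cast; ring
      rw [ch (n + 1) hn, e1]; push_cast; field_simp
    rw [p1, p2]

lemma level (K : ℕ) (hK : 0 < K) (α : ℕ → ℝ) (h0 : ∀ j, 0 ≤ α j)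
    (h1 : ∑ j ∈ Finset.range (K + 1), (K.choose j : ℝ) * α j = 1) (F : ℕ) :
    ∃ c : ℕ → ℕ, ∑ j ∈ Finset.range (K + 1), K.choose j * c j = F ∧
      (∀ j, (c (j + 1) : ℝ) ≤ α (j + 1) * F) ∧ (c 0 : ℝ) ≤ α 0 * F + 2 ^ K := by
  have hb : ∀ j, (⌊α j * F⌋₊ : ℝ) ≤ α j * F := fun j =>
    Nat.floor_le (mul_nonneg (h0 j) (Nat.cast_nonneg F))
  have hb2 : ∀ j, α j * F ≤ (⌊α j * F⌋₊ : ℝ) + 1 := fun j => (Nat.lt_floor_add_one _).le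
  set A : ℕ := ∑ j ∈ Finset.range K, K.choose (j + 1) * ⌊α (j + 1) * F⌋₊ with hA
  have h1' : ∑ j ∈ Finset.range K, (K.choose (j + 1) : ℝ) * (α (j + 1) * F) + α 0 * F = F := by
    rw [Finset.sum_range_succ'] at h1
    have := congrArg (fun y => y * (F : ℝ)) h1
    simp only [add_mul, Finset.sum_mul, one_mul, Nat.choose_zero_right, Nat.cast_one] at this
    simpa only [mul_assoc] using this
  have hAr : (A : ℝ) = ∑ j ∈ Finset.range K, (K.choose (j + 1) : ℝ) * (⌊α (j + 1) * F⌋₊ : ℝ) := by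
    rw [hA]; push_cast; rfl
  have hAF : (A : ℝ) ≤ F := by
    have : (A : ℝ) ≤ ∑ j ∈ Finset.range K, (K.choose (j + 1) : ℝ) * (α (j + 1) * F) := by
      rw [hAr]
      exact Finset.sum_le_sum fun j _ => mul_le_mul_of_nonneg_left (hb _) (Nat.cast_nonneg _)
    have : 0 ≤ α 0 * F := mul_nonneg (h0 0) (Nat.cast_nonneg F)
    linarith
  have hAF' : A ≤ F := by exact_mod_cast hAF
  refine ⟨fun j => if j = 0 then F - A else ⌊α j * F⌋₊, ?_, ?_, ?_⟩
  · rw [Finset.sum_range_succ']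
    simp only [Nat.choose_zero_right, if_true, Nat.add_eq_zero_iff, one_ne_zero, and_false,
      if_false]
    rw [← hA]; omega
  · intro j; simpa using hb (j + 1)
  · simp only [if_true]
    rw [Nat.cast_sub hAF']
    have h2 : ∑ j ∈ Finset.range K, (K.choose (j + 1) : ℝ) * (α (j + 1) * F)
        ≤ A + ∑ j ∈ Finset.range K, (K.choose (j + 1) : ℝ) := by
      rw [hAr, ← Finset.sum_add_distrib]
      refine Finset.sum_le_sum fun j _ => ?_
      have := mul_le_mul_of_nonneg_left (hb2 (j + 1)) (Nat.cast_nonneg (α := ℝ) (K.choose (j + 1)))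
      linarith
    have h3 : ∑ j ∈ Finset.range K, (K.choose (j + 1) : ℝ) ≤ 2 ^ K := by
      have := Nat.sum_range_choose K
      rw [Finset.sum_range_succ'] at this
      have h4 : ∑ j ∈ Finset.range K, K.choose (j + 1) ≤ 2 ^ K := by omega
      exact_mod_cast h4
    linarith

lemma level' (K : ℕ+) (N U : ℕ+) (m : ℝ) (hm0 : 0 ≤ m) (hmN : m ≤ ((N : ℕ) : ℝ)) (F : ℕ) :
    ∃ c : ℕ → ℕ, ∑ j ∈ Finset.range ((K : ℕ) + 1), (K : ℕ).choose j * c j = F ∧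
      ((N : ℕ) : ℝ) * ∑ j ∈ Finset.range (K : ℕ), (((K : ℕ) - 1).choose j : ℝ) * c (j + 1) ≤ m * F ∧
      ((U : ℕ) : ℝ) * ∑ j ∈ Finset.range ((K : ℕ) + 1), ((K : ℕ).choose (j + 1) : ℝ) * c j
        ≤ RSL m K ((N : ℕ) : ℝ) ((U : ℕ) : ℝ) * F + ((U : ℕ) : ℝ) * ((K : ℕ) * 2 ^ (K : ℕ)) := by
  have hK : 0 < (K : ℕ) := K.pos
  have hKr : (0 : ℝ) < (K : ℕ) := by exact_mod_cast hK
  have hNr : (0 : ℝ) < (N : ℕ) := by exact_mod_cast N.pos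
  have hUr : (0 : ℝ) < (U : ℕ) := by exact_mod_cast U.pos
  have hF : (0 : ℝ) ≤ F := Nat.cast_nonneg F
  obtain ⟨n, s, hn, hs0, hs1, hx⟩ := split_pt K hK ((K : ℕ) * m / (N : ℕ)) (by positivity)
    (by rw [div_le_iff₀ hNr]; exact mul_le_mul_of_nonneg_left hmN hKr.le)
  obtain ⟨α, a0, a1, a2, a3⟩ := weights K n s hn hs0 hs1
  obtain ⟨r1, r2⟩ := rate_ineq K n s _ hn hs0 hs1 hx
  obtain ⟨c, c1, c2, c3⟩ := level K hK α a0 a1 F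
  refine ⟨c, c1, ?_, ?_⟩
  · have h1 : ∑ j ∈ Finset.range (K : ℕ), (((K : ℕ) - 1).choose j : ℝ) * c (j + 1)
        ≤ (∑ j ∈ Finset.range (K : ℕ), (((K : ℕ) - 1).choose j : ℝ) * α (j + 1)) * F := by
      rw [Finset.sum_mul]
      refine Finset.sum_le_sum fun j _ => ?_
      rw [mul_assoc]
      exact mul_le_mul_of_nonneg_left (c2 j) (Nat.cast_nonneg _)
    have h2 : ((N : ℕ) : ℝ) * ∑ j ∈ Finset.range (K : ℕ), (((K : ℕ) - 1).choose j : ℝ) * α (j + 1)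
        = m := by
      rw [← hx] at a2
      field_simp at a2
      linarith
    calc _ ≤ _ := mul_le_mul_of_nonneg_left h1 hNr.le
      _ = _ := by rw [← mul_assoc, h2]
  · have h1 : ∑ j ∈ Finset.range ((K : ℕ) + 1), ((K : ℕ).choose (j + 1) : ℝ) * c j
        ≤ (∑ j ∈ Finset.range ((K : ℕ) + 1), ((K : ℕ).choose (j + 1) : ℝ) * α j) * F
          + (K : ℕ) * 2 ^ (K : ℕ) := by
      rw [Finset.sum_range_succ', Finset.sum_range_succ', add_mul, Finset.sum_mul]
      have : ∑ j ∈ Finset.range (K : ℕ), ((K : ℕ).choose (j + 1 + 1) : ℝ) * c (j + 1)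
        ≤ ∑ j ∈ Finset.range (K : ℕ), ((K : ℕ).choose (j + 1 + 1) : ℝ) * α (j + 1) * F := by
        refine Finset.sum_le_sum fun j _ => ?_
        rw [mul_assoc]
        exact mul_le_mul_of_nonneg_left (c2 j) (Nat.cast_nonneg _)
      have h5 := mul_le_mul_of_nonneg_left c3 hKr.le
      simp only [zero_add, Nat.choose_one_right]
      linarith
    have h2 : ((U : ℕ) : ℝ) * ∑ j ∈ Finset.range ((K : ℕ) + 1), ((K : ℕ).choose (j + 1) : ℝ) * α j
        ≤ RSL m K ((N : ℕ) : ℝ) ((U : ℕ) : ℝ) := by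
      rw [a3]
      unfold RSL
      split_ifs with hm
      · subst hm
        simp only [mul_zero, zero_div, sub_zero] at r1
        exact mul_le_mul_of_nonneg_left r1 hUr.le
      · have hmp : 0 < m := lt_of_le_of_ne hm0 (Ne.symm hm)
        rw [mul_assoc]
        refine mul_le_mul_of_nonneg_left ?_ hUr.le
        rcases min_choice (((N : ℕ) : ℝ) / m) ((K : ℕ) : ℝ) with h | h <;> rw [h]
        · refine (r2 (by positivity)).trans (le_of_eq ?_)
          field_simp
        · refine r1.trans (le_of_eq ?_)
          field_simp
    calc _ ≤ _ := mul_le_mul_of_nonneg_left h1 hUr.le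
      _ = _ := by rw [mul_add, ← mul_assoc]
      _ ≤ _ := by gcongr

lemma RSL_nonneg (K : ℕ+) (N U : ℕ+) (m : ℝ) (hm0 : 0 ≤ m) (hmN : m ≤ ((N : ℕ) : ℝ)) :
    0 ≤ RSL m K ((N : ℕ) : ℝ) ((U : ℕ) : ℝ) := by
  unfold RSL
  have hNr : (0 : ℝ) < (N : ℕ) := by exact_mod_cast N.pos
  split_ifs
  · positivity
  · have : 0 ≤ 1 - m / ((N : ℕ) : ℝ) := by
      rw [sub_nonneg, div_le_one hNr]; exact hmN
    have : 0 ≤ min (((N : ℕ) : ℝ) / m) ((K : ℕ) : ℝ) := le_min (by positivity) (by positivity)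
    positivity

end MemShare

open MemShare

/-- Memory-sharing achievability in the multi-user coded caching model: given
memories `m i` with `0 ≤ m i ≤ N i` and `∑ i, m i ≤ M`, the pair
`(∑ i, R^SL(m_i, K, N_i, U_i), M)` is achievable; in particular
`R*(M) ≤ ∑ i, R^SL(m_i, K, N_i, U_i)`. -/
theorem memory_sharing_achievable (L : ℕ) (N U : Fin L → ℕ+) (K : ℕ+)
    (M : ℝ) (hM : 0 ≤ M) (m : Fin L → ℝ)
    (hm0 : ∀ i, 0 ≤ m i) (hmN : ∀ i, m i ≤ ((N i : ℕ) : ℝ))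
    (hsum : ∑ i, m i ≤ M) :
    MUAchievable L N U K
      (∑ i, RSL (m i) K ((N i : ℕ) : ℝ) ((U i : ℕ) : ℝ)) M ∧
    RstarMU L N U K M ≤ ∑ i, RSL (m i) K ((N i : ℕ) : ℝ) ((U i : ℕ) : ℝ) := by
  have hR : 0 ≤ ∑ i, RSL (m i) K ((N i : ℕ) : ℝ) ((U i : ℕ) : ℝ) :=
    Finset.sum_nonneg fun i _ => RSL_nonneg K (N i) (U i) (m i) (hm0 i) (hmN i)
  have hach : MUAchievable L N U K
      (∑ i, RSL (m i) K ((N i : ℕ) : ℝ) ((U i : ℕ) : ℝ)) M := by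
    refine ⟨hR, hM, fun ε hε => ?_⟩
    obtain ⟨F0, hF0⟩ := exists_nat_ge
      ((∑ i, ((U i : ℕ) : ℝ) * ((K : ℕ) * 2 ^ (K : ℕ))) / ε)
    rw [div_le_iff₀ hε] at hF0
    let F : ℕ+ := ⟨F0 + 1, Nat.succ_pos _⟩
    have hFF : ((F : ℕ) : ℝ) = F0 + 1 := by simp [F]
    choose c c1 c2 c3 using fun i => level' K (N i) (U i) (m i) (hm0 i) (hmN i) F
    obtain ⟨Z, X, dec, h⟩ := assemble L N U K F c c1
    refine ⟨F, _, _, Z, X, dec, ?_, ?_, h⟩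
    · rw [Nat.cast_pow, Nat.cast_ofNat, ← Real.rpow_natCast]
      refine Real.rpow_le_rpow_of_exponent_le (by norm_num) ?_
      push_cast
      calc _ ≤ ∑ i, m i * ((F : ℕ) : ℝ) := Finset.sum_le_sum fun i _ => c2 i
        _ = (∑ i, m i) * ((F : ℕ) : ℝ) := by rw [Finset.sum_mul]
        _ ≤ _ := mul_le_mul_of_nonneg_right hsum (Nat.cast_nonneg _)
    · rw [Nat.cast_pow, Nat.cast_ofNat, ← Real.rpow_natCast]
      refine Real.rpow_le_rpow_of_exponent_le (by norm_num) ?_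
      push_cast
      refine (Finset.sum_le_sum fun i _ => c3 i).trans ?_
      rw [Finset.sum_add_distrib, ← Finset.sum_mul, add_mul]
      have : ε * ((F : ℕ) : ℝ) = F0 * ε + ε := by rw [hFF]; ring
      linarith
  exact ⟨hach, csInf_le ⟨0, fun R hR => hR.1⟩ hach⟩
end

section
/- Consider the multi-user coded caching model with L levels, N_i ∈ ℕ+ files and U_i ∈ ℕ+ users per cache for each level i, K ∈ ℕ+ caches, and memory M ≥ 0. Let b ∈ ℕ+, let t ∈ {1, …, K}, and for each level i let s_i ∈ {1, …, ⌊K/(2t)⌋} (assuming ⌊K/(2t)⌋ ≥ 1). Then the optimal rate satisfies R*(M) ≥ Σ_{i=1}^{L} min{ s_i·t·U_i , N_i/(s_i·b) } − (t/b)·M. -/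
section Entropy
open Classical Finset

/-- class size -/
noncomputable def muCl {Ω : Type} [Fintype Ω] (r : Setoid Ω) (w : Ω) : ℝ :=
  ∑ w' : Ω, if r w w' then (1 : ℝ) else 0

/-- entropy (nats) of a partition under the uniform law -/
noncomputable def muH {Ω : Type} [Fintype Ω] (r : Setoid Ω) : ℝ :=
  Real.log (Fintype.card Ω) - (∑ w : Ω, Real.log (muCl r w)) / (Fintype.card Ω)

variable {Ω : Type} [Fintype Ω]

lemma muCl_ge_one (r : Setoid Ω) (w : Ω) : 1 ≤ muCl r w := by
  unfold muCl
  have := Finset.single_le_sum (f := fun w' => if r w w' then (1 : ℝ) else 0) (s := univ)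
    (fun i _ => by split_ifs <;> norm_num) (mem_univ w)
  simpa [r.refl' w] using this

lemma muCl_mono {r r' : Setoid Ω} (h : r ≤ r') (w : Ω) : muCl r w ≤ muCl r' w := by
  unfold muCl
  apply Finset.sum_le_sum
  intro x _
  by_cases h1 : r w x
  · simp [h1, h h1]
  · simp only [h1, if_false]; split_ifs <;> norm_num

lemma muCl_congr {r : Setoid Ω} {w w' : Ω} (h : r w w') : muCl r w = muCl r w' := by
  unfold muCl
  apply Finset.sum_congr rfl
  intro x _
  have : r w x ↔ r w' x := ⟨fun h1 => r.trans' (r.symm' h) h1, fun h1 => r.trans' h h1⟩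
  simp [this]

lemma muH_anti [Nonempty Ω] {r r' : Setoid Ω} (h : r ≤ r') : muH r' ≤ muH r := by
  unfold muH
  have : (∑ w : Ω, Real.log (muCl r w)) ≤ ∑ w : Ω, Real.log (muCl r' w) :=
    Finset.sum_le_sum fun w _ =>
      Real.log_le_log (by linarith [muCl_ge_one r w]) (muCl_mono h w)
  have := div_le_div_of_nonneg_right this (Nat.cast_nonneg (α := ℝ) (Fintype.card Ω))
  linarith

lemma muCl_ratio_sum {a b c : Setoid Ω} (ha : a ≤ c) (hb : b ≤ c) :
    ∑ w : Ω, muCl a w * muCl b w / (muCl (a ⊓ b) w * muCl c w) ≤ Fintype.card Ω := by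
  have e1 : ∀ w : Ω, muCl a w * muCl b w / (muCl (a ⊓ b) w * muCl c w)
      = ∑ x : Ω, ∑ y : Ω, (if a w x ∧ b w y then 1 / (muCl (a ⊓ b) w * muCl c w) else 0) := by
    intro w
    rw [div_eq_mul_one_div]
    conv_lhs => rw [show muCl a w = ∑ w' : Ω, if a w w' then (1 : ℝ) else 0 from rfl,
      show muCl b w = ∑ w' : Ω, if b w w' then (1 : ℝ) else 0 from rfl]
    rw [Finset.sum_mul_sum, Finset.sum_mul]
    apply Finset.sum_congr rfl; intro x _
    rw [Finset.sum_mul]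
    apply Finset.sum_congr rfl; intro y _
    by_cases h1 : a w x <;> by_cases h2 : b w y <;> simp [h1, h2]
  simp_rw [e1]
  rw [Finset.sum_comm]
  have e2 : ∀ x : Ω, ∑ w : Ω, ∑ y : Ω,
      (if a w x ∧ b w y then 1 / (muCl (a ⊓ b) w * muCl c w) else 0) ≤ 1 := by
    intro x
    rw [Finset.sum_comm]
    have e3 : ∀ y : Ω, ∑ w : Ω,
        (if a w x ∧ b w y then 1 / (muCl (a ⊓ b) w * muCl c w) else 0)
        ≤ (if c x y then 1 else 0) * (1 / muCl c x) := by
      intro y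
      have pc : 0 < muCl c x := by linarith [muCl_ge_one c x]
      by_cases hex : ∃ v, a v x ∧ b v y
      · obtain ⟨v, hv1, hv2⟩ := hex
        have hc : c x y := c.trans' (c.symm' (ha hv1)) (hb hv2)
        have e4 : ∀ w : Ω, (if a w x ∧ b w y then 1 / (muCl (a ⊓ b) w * muCl c w) else 0)
            = (if (a ⊓ b) v w then (1 : ℝ) else 0) * (1 / (muCl (a ⊓ b) v * muCl c x)) := by
          intro w
          have iff1 : (a w x ∧ b w y) ↔ (a ⊓ b) v w := by
            constructor
            · rintro ⟨h1, h2⟩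
              exact ⟨a.trans' hv1 (a.symm' h1), b.trans' hv2 (b.symm' h2)⟩
            · rintro ⟨h1, h2⟩
              exact ⟨a.trans' (a.symm' h1) hv1, b.trans' (b.symm' h2) hv2⟩
          by_cases h : (a ⊓ b) v w
          · rw [if_pos (iff1.2 h), if_pos h, muCl_congr h, muCl_congr (ha (iff1.2 h).1), one_mul]
          · rw [if_neg (fun h' => h (iff1.1 h')), if_neg h, zero_mul]
        simp_rw [e4]
        rw [← Finset.sum_mul, if_pos hc]
        have pv : 0 < muCl (a ⊓ b) v := by linarith [muCl_ge_one (a ⊓ b) v]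
        change muCl (a ⊓ b) v * _ ≤ _
        apply le_of_eq
        field_simp
      · have : ∀ w : Ω, ¬ (a w x ∧ b w y) := fun w hw => hex ⟨w, hw⟩
        simp only [this, if_false, Finset.sum_const_zero]
        split_ifs <;> positivity
    refine (Finset.sum_le_sum fun y _ => e3 y).trans ?_
    rw [← Finset.sum_mul]
    change muCl c x * _ ≤ _
    have pc : 0 < muCl c x := by linarith [muCl_ge_one c x]
    apply le_of_eq
    field_simp
  refine (Finset.sum_le_sum fun x _ => e2 x).trans ?_
  simp

lemma muH_submod [Nonempty Ω] {a b c : Setoid Ω} (ha : a ≤ c) (hb : b ≤ c) :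
    muH (a ⊓ b) + muH c ≤ muH a + muH b := by
  have key : ∑ w : Ω, (Real.log (muCl a w) + Real.log (muCl b w)
      - Real.log (muCl (a ⊓ b) w) - Real.log (muCl c w)) ≤ 0 := by
    have h1 : ∀ w : Ω, (Real.log (muCl a w) + Real.log (muCl b w)
      - Real.log (muCl (a ⊓ b) w) - Real.log (muCl c w)) ≤
        muCl a w * muCl b w / (muCl (a ⊓ b) w * muCl c w) - 1 := by
      intro w
      have p1 := muCl_ge_one a w
      have p2 := muCl_ge_one b w
      have p3 := muCl_ge_one (a ⊓ b) w
      have p4 := muCl_ge_one c w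
      have := Real.log_le_sub_one_of_pos
        (show 0 < muCl a w * muCl b w / (muCl (a ⊓ b) w * muCl c w) by positivity)
      rw [Real.log_div (by positivity) (by positivity), Real.log_mul (by positivity) (by positivity),
        Real.log_mul (by positivity) (by positivity)] at this
      linarith
    refine (Finset.sum_le_sum fun w _ => h1 w).trans ?_
    rw [Finset.sum_sub_distrib]
    have := muCl_ratio_sum ha hb
    simp only [Finset.sum_const, Finset.card_univ, nsmul_eq_mul, mul_one]
    linarith
  simp only [Finset.sum_sub_distrib, Finset.sum_add_distrib] at key
  unfold muH
  have hp : (0 : ℝ) < Fintype.card Ω := by exact_mod_cast Fintype.card_pos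
  have := div_le_div_of_nonneg_right key hp.le
  rw [sub_div, sub_div, add_div, zero_div] at this
  linarith

lemma muH_ker_le [Nonempty Ω] {α : Type} [Fintype α] (f : Ω → α) :
    muH (Setoid.ker f) ≤ Real.log (Fintype.card α) := by
  have hp : (0 : ℝ) < Fintype.card Ω := by exact_mod_cast Fintype.card_pos
  have : Nonempty α := ⟨f (Classical.arbitrary Ω)⟩
  have hq : (0 : ℝ) < Fintype.card α := by exact_mod_cast Fintype.card_pos
  have s1 : ∑ w : Ω, 1 / muCl (Setoid.ker f) w ≤ Fintype.card α := by
    rw [← Finset.sum_fiberwise (s := univ) (g := f)]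
    have : ∀ y : α, ∑ w ∈ univ.filter (fun w => f w = y), 1 / muCl (Setoid.ker f) w ≤ 1 := by
      intro y
      by_cases hex : ∃ v, f v = y
      · obtain ⟨v, rfl⟩ := hex
        have : ∀ w ∈ univ.filter (fun w => f w = f v), 1 / muCl (Setoid.ker f) w
            = 1 / muCl (Setoid.ker f) v := by
          intro w hw
          rw [muCl_congr (show Setoid.ker f w v from by simpa using hw)]
        rw [Finset.sum_congr rfl this, Finset.sum_const, nsmul_eq_mul]
        have e : muCl (Setoid.ker f) v = ((univ.filter (fun w => f w = f v)).card : ℝ) := by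
          unfold muCl
          rw [Finset.card_filter]
          push_cast
          apply Finset.sum_congr rfl
          intro x _
          simp [eq_comm]
        have p := muCl_ge_one (Setoid.ker f) v
        rw [← e]
        apply le_of_eq
        field_simp
      · have : univ.filter (fun w => f w = y) = ∅ := by
          ext w; simp; exact fun h => hex ⟨w, h⟩
        rw [this]; simp
    refine (Finset.sum_le_sum fun y _ => this y).trans ?_
    simp
  have s2 : ∑ w : Ω, (Real.log (Fintype.card Ω) - Real.log (muCl (Setoid.ker f) w)
      - Real.log (Fintype.card α)) ≤ 0 := by
    have h1 : ∀ w : Ω, (Real.log (Fintype.card Ω) - Real.log (muCl (Setoid.ker f) w)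
      - Real.log (Fintype.card α)) ≤
        (Fintype.card Ω / Fintype.card α) * (1 / muCl (Setoid.ker f) w) - 1 := by
      intro w
      have p1 := muCl_ge_one (Setoid.ker f) w
      have := Real.log_le_sub_one_of_pos
        (show 0 < ((Fintype.card Ω : ℝ) / Fintype.card α) * (1 / muCl (Setoid.ker f) w) by positivity)
      rw [Real.log_mul (by positivity) (by positivity), Real.log_div (by positivity) (by positivity),
        Real.log_div (by positivity) (by positivity), Real.log_one] at this
      linarith
    refine (Finset.sum_le_sum fun w _ => h1 w).trans ?_
    rw [Finset.sum_sub_distrib, ← Finset.mul_sum]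
    simp only [Finset.sum_const, Finset.card_univ, nsmul_eq_mul, mul_one]
    have := mul_le_mul_of_nonneg_left s1 (show 0 ≤ (Fintype.card Ω : ℝ) / Fintype.card α by positivity)
    rw [div_mul_cancel₀ _ hq.ne'] at this
    linarith
  simp only [Finset.sum_sub_distrib, Finset.sum_const, Finset.card_univ, nsmul_eq_mul] at s2
  unfold muH
  have := div_le_div_of_nonneg_right s2 hp.le
  rw [sub_div, sub_div, zero_div, mul_div_cancel_left₀ _ hp.ne', mul_div_cancel_left₀ _ hp.ne'] at this
  linarith

/-- window -/
def muWin (Y : ℕ → Setoid Ω) (p s : ℕ) : Setoid Ω where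
  r w w' := ∀ j, p ≤ j → j < p + s → Y j w w'
  iseqv := ⟨fun w j _ _ => (Y j).refl' w, fun h j h1 h2 => (Y j).symm' (h j h1 h2),
    fun h h' j h1 h2 => (Y j).trans' (h j h1 h2) (h' j h1 h2)⟩

/-- window sum conditional on V -/
noncomputable def muE (Y : ℕ → Setoid Ω) (m : ℕ) (V : Setoid Ω) (s : ℕ) : ℝ :=
  ∑ p ∈ range m, (muH (muWin Y p s ⊓ V) - muH V)

lemma muWin_shift (Y : ℕ → Setoid Ω) (m : ℕ) (hY : ∀ j, Y (j + m) = Y j) (p s : ℕ) :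
    muWin Y (p + m) s = muWin Y p s := by
  ext w w'
  change (∀ j, p + m ≤ j → j < p + m + s → Y j w w') ↔ (∀ j, p ≤ j → j < p + s → Y j w w')
  constructor
  · intro h j h1 h2
    have := h (j + m) (by omega) (by omega)
    rwa [hY] at this
  · intro h j h1 h2
    have := h (j - m) (by omega) (by omega)
    rw [← hY, Nat.sub_add_cancel (by omega)] at this
    exact this

lemma muE_zero (Y : ℕ → Setoid Ω) (m : ℕ) (V : Setoid Ω) : muE Y m V 0 = 0 := by
  unfold muE
  apply Finset.sum_eq_zero
  intro p _
  have : muWin Y p 0 ⊓ V = V := by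
    apply le_antisymm inf_le_right
    apply le_inf _ le_rfl
    intro w w' _ j h1 h2
    omega
  rw [this, sub_self]

lemma muE_nonneg [Nonempty Ω] (Y : ℕ → Setoid Ω) (m : ℕ) (V : Setoid Ω) (s : ℕ) :
    0 ≤ muE Y m V s := by
  apply Finset.sum_nonneg
  intro p _
  have : muH V ≤ muH (muWin Y p s ⊓ V) := muH_anti inf_le_right
  linarith

lemma muE_concave [Nonempty Ω] (Y : ℕ → Setoid Ω) (m : ℕ) (hY : ∀ j, Y (j + m) = Y j)
    (V : Setoid Ω) (s : ℕ) :
    muE Y m V (s + 2) + muE Y m V s ≤ 2 * muE Y m V (s + 1) := by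
  have shift : ∀ r, muE Y m V r = ∑ p ∈ range m, (muH (muWin Y (p + 1) r ⊓ V) - muH V) := by
    intro r
    unfold muE
    have h1 := Finset.sum_range_succ' (fun p => muH (muWin Y p r ⊓ V) - muH V) m
    have h2 := Finset.sum_range_succ (fun p => muH (muWin Y p r ⊓ V) - muH V) m
    have h3 : muWin Y m r = muWin Y 0 r := by
      have := muWin_shift Y m hY 0 r
      simpa using this
    simp only [h3] at h2
    linarith
  have e : 2 * muE Y m V (s + 1) = muE Y m V (s + 1) +
      ∑ p ∈ range m, (muH (muWin Y (p + 1) (s + 1) ⊓ V) - muH V) := by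
    rw [← shift]; ring
  rw [e, shift s]
  unfold muE
  rw [← Finset.sum_add_distrib, ← Finset.sum_add_distrib]
  apply Finset.sum_le_sum
  intro p _
  have := muH_submod (a := muWin Y p (s + 1) ⊓ V) (b := muWin Y (p + 1) (s + 1) ⊓ V)
    (c := muWin Y (p + 1) s ⊓ V)
    (inf_le_inf_right V fun {w w'} h j h1 h2 => h j (by omega) (by omega))
    (inf_le_inf_right V fun {w w'} h j h1 h2 => h j (by omega) (by omega))
  have e2 : (muWin Y p (s + 1) ⊓ V) ⊓ (muWin Y (p + 1) (s + 1) ⊓ V) = muWin Y p (s + 2) ⊓ V := by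
    ext w w'
    constructor
    · rintro ⟨⟨h1, hV⟩, ⟨h2, -⟩⟩
      refine ⟨fun j h3 h4 => ?_, hV⟩
      by_cases hj : j < p + (s + 1)
      · exact h1 j h3 hj
      · exact h2 j (by omega) (by omega)
    · rintro ⟨h1, hV⟩
      exact ⟨⟨fun j h3 h4 => h1 j h3 (by omega), hV⟩,
        ⟨fun j h3 h4 => h1 j (by omega) (by omega), hV⟩⟩
  rw [e2] at this
  linarith

lemma muE_div_succ [Nonempty Ω] (Y : ℕ → Setoid Ω) (m : ℕ) (hY : ∀ j, Y (j + m) = Y j)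
    (V : Setoid Ω) (s : ℕ) :
    s * muE Y m V (s + 1) ≤ (s + 1) * muE Y m V s := by
  induction s with
  | zero => simp [muE_zero]
  | succ k ih =>
    have := muE_concave Y m hY V k
    push_cast
    have h2 := mul_le_mul_of_nonneg_left this (show (0 : ℝ) ≤ k + 1 by positivity)
    nlinarith

lemma muE_div_anti [Nonempty Ω] (Y : ℕ → Setoid Ω) (m : ℕ) (hY : ∀ j, Y (j + m) = Y j)
    (V : Setoid Ω) (s s' : ℕ) (h1 : 1 ≤ s) (h : s ≤ s') :
    muE Y m V s' / s' ≤ muE Y m V s / s := by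
  induction s', h using Nat.le_induction with
  | base => exact le_rfl
  | succ k hk ih =>
    refine le_trans ?_ ih
    have := muE_div_succ Y m hY V k
    have hk0 : (0 : ℝ) < k := by exact_mod_cast (by omega : 0 < k)
    rw [div_le_div_iff₀ (by positivity) hk0]
    push_cast
    linarith

lemma mu_chain [Nonempty Ω] {ι : Type} [Fintype ι] [DecidableEq ι] (Y : ℕ → Setoid Ω) (m : ℕ)
    (hY : ∀ j, Y (j + m) = Y j)
    (V : Finset ι → Setoid Ω) (s : ι → ℕ) (hs : ∀ i, 1 ≤ s i) (a : ι → ℝ)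
    (hstep : ∀ (S : Finset ι) (i : ι), i ∉ S →
      a i + muE Y m (V (insert i S)) (s i) ≤ muE Y m (V S) (s i)) :
    ∑ i, a i / s i ≤ muE Y m (V ∅) 1 := by
  have main : ∀ S : Finset ι, ∀ r : ℕ, 1 ≤ r → (∀ i ∈ S, s i ≤ r) →
      ∑ i ∈ S, a i / s i + muE Y m (V S) r / r ≤ muE Y m (V ∅) 1 := by
    intro S
    induction S using Finset.induction_on_max_value s with
    | empty =>
      intro r hr _
      have := muE_div_anti Y m hY (V ∅) 1 r le_rfl hr
      simpa using this
    | insert i S hi hmax ih =>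
      intro r hr hS
      have h1 := ih (s i) (hs i) hmax
      have h2 := hstep S i hi
      have h3 := muE_div_anti Y m hY (V (insert i S)) (s i) r (hs i) (hS i (by simp))
      have h4 := div_le_div_of_nonneg_right h2 (Nat.cast_nonneg (α := ℝ) (s i))
      rw [add_div] at h4
      rw [Finset.sum_insert hi]
      linarith
  obtain ⟨r, hr⟩ : ∃ r, ∀ i, s i ≤ r := ⟨∑ i, s i, fun i =>
    Finset.single_le_sum (f := s) (fun _ _ => Nat.zero_le _) (mem_univ i)⟩
  have := main univ (r + 1) (by omega) (fun i _ => (hr i).trans (by omega))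
  have h2 := div_nonneg (muE_nonneg Y m (V univ) (r + 1)) (Nat.cast_nonneg (α := ℝ) (r + 1))
  linarith

lemma mu_step [Nonempty Ω] (Y : ℕ → Setoid Ω) (m : ℕ) (V V' Q : Setoid Ω) (s : ℕ) (c : ℝ)
    (hV' : V' ≤ V) (hVQ : V' ≤ Q) (hQ : ∀ p, muWin Y p s ⊓ V ≤ Q) (hc : muH V + c ≤ muH Q) :
    m * c + muE Y m V' s ≤ muE Y m V s := by
  have : (m : ℝ) * c = ∑ p ∈ range m, c := by simp
  rw [this]
  unfold muE
  rw [← Finset.sum_add_distrib]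
  apply Finset.sum_le_sum
  intro p _
  have h := muH_submod (hQ p) hVQ
  have e : muWin Y p s ⊓ V ⊓ V' = muWin Y p s ⊓ V' := by
    rw [inf_assoc, inf_eq_right.2 hV']
  rw [e] at h
  linarith

end Entropy

section Arith

/-- residue of the lift of block `c` close to `j` -/
def muLift (n s j c : ℕ) : ℕ :=
  if (c + n - j % n) % n < s then (j + (c + n - j % n) % n) % s
  else (j + (c + n - j % n) % n + (s - 1) * n) % s

lemma muLift_spec (n s j j' : ℕ) (hs : 0 < s) (hn : 2 * s ≤ n) (h1 : j < j' + s)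
    (h2 : j' < j + s) : muLift n s j (j' % n) = j' % s := by
  have hn0 : 0 < n := by omega
  have hjn := Nat.mod_lt j hn0
  unfold muLift
  rcases le_or_gt j j' with h | h
  · obtain ⟨e, rfl⟩ := Nat.exists_eq_add_of_le h
    have hd : ((j + e) % n + n - j % n) % n = e := by
      rw [Nat.add_mod]
      rw [Nat.mod_eq_of_lt (show e < n by omega)]
      rcases lt_or_ge (j % n + e) n with hl | hl
      · rw [Nat.mod_eq_of_lt hl, show j % n + e + n - j % n = e + n by omega, Nat.add_mod_right,
          Nat.mod_eq_of_lt (by omega)]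
      · rw [Nat.mod_eq_sub_mod hl, Nat.mod_eq_of_lt (show j % n + e - n < n by omega),
          show j % n + e - n + n - j % n = e by omega, Nat.mod_eq_of_lt (by omega)]
    rw [hd, if_pos (by omega)]
  · obtain ⟨e, rfl⟩ := Nat.exists_eq_add_of_le h.le
    have hd : (j' % n + n - (j' + e) % n) % n = n - e := by
      have hj2 := Nat.mod_lt j' hn0
      rw [Nat.add_mod]
      rw [Nat.mod_eq_of_lt (show e < n by omega)]
      rcases lt_or_ge (j' % n + e) n with hl | hl
      · rw [Nat.mod_eq_of_lt hl, show j' % n + n - (j' % n + e) = n - e by omega,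
          Nat.mod_eq_of_lt (by omega)]
      · rw [Nat.mod_eq_sub_mod hl, Nat.mod_eq_of_lt (show j' % n + e - n < n by omega),
          show j' % n + n - (j' % n + e - n) = n - e + n by omega, Nat.add_mod_right,
          Nat.mod_eq_of_lt (by omega)]
    rw [hd, if_neg (by omega)]
    obtain ⟨q, rfl⟩ : ∃ q, s = q + 1 := ⟨s - 1, by omega⟩
    have : j' + e + (n - e) + (q + 1 - 1) * n = j' + (q + 1) * n := by
      rw [Nat.add_sub_cancel, add_mul]; omega
    rw [this, Nat.add_mul_mod_self_left]

lemma muLift_periodic (n s j c m : ℕ) (h1 : n ∣ m) (h2 : s ∣ m) :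
    muLift n s (j + m) c = muLift n s j c := by
  obtain ⟨q, rfl⟩ := h1
  obtain ⟨r, hr⟩ := h2
  unfold muLift
  rw [Nat.add_mul_mod_self_left, hr]
  rw [show ∀ x, j + s * r + x = j + x + s * r by intro x; omega]
  rw [show ∀ x y, j + x + s * r + y = j + x + y + s * r by intro x y; omega]
  rw [Nat.add_mul_mod_self_left, Nat.add_mul_mod_self_left]

/-- slot index -/
def muIdx (s t b U x y τ β u : ℕ) : ℕ := (((x * s + y) * t + τ) * b + β) * U + u

lemma muIdx_surj (s t b U f : ℕ) (hf : f < s * s * t * b * U) :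
    ∃ x y τ β u, x < s ∧ y < s ∧ τ < t ∧ β < b ∧ u < U ∧ muIdx s t b U x y τ β u = f := by
  have pos : 0 < s * s * t * b * U := by omega
  have hU : 0 < U := Nat.pos_of_mul_pos_left pos
  have h1 : 0 < s * s * t * b := Nat.pos_of_mul_pos_right pos
  have hb : 0 < b := Nat.pos_of_mul_pos_left h1
  have h2 : 0 < s * s * t := Nat.pos_of_mul_pos_right h1
  have ht : 0 < t := Nat.pos_of_mul_pos_left h2
  have h3 : 0 < s * s := Nat.pos_of_mul_pos_right h2
  have hs : 0 < s := Nat.pos_of_mul_pos_left h3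
  refine ⟨f / U / b / t / s, f / U / b / t % s, f / U / b % t, f / U % b, f % U, ?_,
    Nat.mod_lt _ hs, Nat.mod_lt _ ht, Nat.mod_lt _ hb, Nat.mod_lt _ hU, ?_⟩
  · rw [Nat.div_lt_iff_lt_mul hs, Nat.div_lt_iff_lt_mul ht, Nat.div_lt_iff_lt_mul hb,
      Nat.div_lt_iff_lt_mul hU]
    exact hf
  · unfold muIdx
    rw [Nat.div_add_mod', Nat.div_add_mod', Nat.div_add_mod', Nat.div_add_mod']

lemma mu_window_residue (p s x : ℕ) (hx : x < s) : ∃ j, p ≤ j ∧ j < p + s ∧ j % s = x := by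
  have hs : 0 < s := by omega
  have hp := Nat.mod_lt p hs
  have hdm := Nat.div_add_mod p s
  rcases le_or_gt (p % s) x with h | h
  · refine ⟨s * (p / s) + x, by omega, by omega, ?_⟩
    rw [Nat.mul_add_mod, Nat.mod_eq_of_lt hx]
  · refine ⟨s * (p / s + 1) + x, by rw [mul_add]; omega, by rw [mul_add]; omega, ?_⟩
    rw [Nat.mul_add_mod, Nat.mod_eq_of_lt hx]

end Arith

section Library
open Classical Finset

noncomputable instance muLibFintype (L : ℕ) (N : Fin L → ℕ+) (F : ℕ) : Fintype (MULibrary L N F) :=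
  inferInstanceAs (Fintype ((i : Fin L) → Fin (N i) → Fin F → Bool))

instance muLibNonempty (L : ℕ) (N : Fin L → ℕ+) (F : ℕ) : Nonempty (MULibrary L N F) :=
  ⟨fun _ _ _ => false⟩

/-- agreement on a set of files -/
def muAgree {L : ℕ} {N : Fin L → ℕ+} {F : ℕ} (P : (i : Fin L) → Fin (N i) → Prop) :
    Setoid (MULibrary L N F) where
  r w w' := ∀ i f, P i f → w i f = w' i f
  iseqv := ⟨fun w i f _ => rfl, fun h i f h1 => (h i f h1).symm,
    fun h h' i f h1 => (h i f h1).trans (h' i f h1)⟩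

lemma muCard_lib (L : ℕ) (N : Fin L → ℕ+) (F : ℕ) :
    Fintype.card (MULibrary L N F) = ∏ i : Fin L, ∏ _f : Fin (N i), 2 ^ F := by
  change Fintype.card ((i : Fin L) → Fin (N i) → Fin F → Bool) = _
  simp

lemma muCl_agree_raw {L : ℕ} {N : Fin L → ℕ+} {F : ℕ} (P : (i : Fin L) → Fin (N i) → Prop)
    (w : (i : Fin L) → Fin (N i) → Fin F → Bool) :
    (∑ w' : (i : Fin L) → Fin (N i) → Fin F → Bool,
      @ite ℝ (∀ i f, P i f → w i f = w' i f) (Classical.propDecidable _) 1 0)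
     = ∏ i : Fin L, ∏ f : Fin (N i), if P i f then (1 : ℝ) else 2 ^ F := by
  have h : (univ.filter (fun w' : (i : Fin L) → Fin (N i) → Fin F → Bool =>
      ∀ i f, P i f → w i f = w' i f)) =
      Fintype.piFinset (fun i : Fin L => Fintype.piFinset (fun f : Fin (N i) =>
        if P i f then ({w i f} : Finset (Fin F → Bool)) else univ)) := by
    ext w'
    simp only [Fintype.mem_piFinset, mem_filter, mem_univ, true_and]
    refine forall_congr' fun i => forall_congr' fun f => ?_
    by_cases hp : P i f <;> simp [hp, eq_comm]
  have h2 := congrArg (fun s : Finset ((i : Fin L) → Fin (N i) → Fin F → Bool) => (s.card : ℝ)) h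
  simp only [Finset.card_filter, Fintype.card_piFinset] at h2
  push_cast at h2
  have h3 : ∀ (i : Fin L) (f : Fin (N i)),
      (((if P i f then ({w i f} : Finset (Fin F → Bool)) else univ).card : ℕ) : ℝ)
        = if P i f then (1 : ℝ) else 2 ^ F := by
    intro i f
    by_cases hp : P i f <;> simp [hp]
  simp only [h3] at h2
  rw [← h2]
  refine Finset.sum_congr rfl fun w' _ => ?_
  congr

lemma muCl_agree {L : ℕ} {N : Fin L → ℕ+} {F : ℕ} (P : (i : Fin L) → Fin (N i) → Prop)
    (w : MULibrary L N F) :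
    muCl (muAgree P) w = ∏ i : Fin L, ∏ f : Fin (N i), if P i f then (1 : ℝ) else 2 ^ F :=
  muCl_agree_raw P w

lemma muH_agree {L : ℕ} {N : Fin L → ℕ+} {F : ℕ} (P : (i : Fin L) → Fin (N i) → Prop) :
    muH (muAgree P : Setoid (MULibrary L N F)) =
      ∑ i : Fin L, ∑ f : Fin (N i), if P i f then (F : ℝ) * Real.log 2 else 0 := by
  have hp : (0 : ℝ) < Fintype.card (MULibrary L N F) := by exact_mod_cast Fintype.card_pos
  unfold muH
  simp_rw [muCl_agree]
  rw [Finset.sum_const, Finset.card_univ, nsmul_eq_mul, mul_div_cancel_left₀ _ hp.ne', muCard_lib]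
  push_cast
  have pos : ∀ (i : Fin L) (f : Fin (N i)), (if P i f then (1 : ℝ) else 2 ^ F) ≠ 0 := by
    intro i f; split_ifs <;> positivity
  rw [Real.log_prod (fun i _ => Finset.prod_ne_zero_iff.2 fun f _ => by positivity),
    Real.log_prod (fun i _ => Finset.prod_ne_zero_iff.2 fun f _ => pos i f),
    ← Finset.sum_sub_distrib]
  refine Finset.sum_congr rfl fun i _ => ?_
  rw [Real.log_prod (fun f _ => by positivity), Real.log_prod (fun f _ => pos i f),
    ← Finset.sum_sub_distrib]
  refine Finset.sum_congr rfl fun f _ => ?_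
  by_cases hp : P i f <;> simp [hp]

lemma muH_agree_level {L : ℕ} {N : Fin L → ℕ+} {F : ℕ} (S : Finset (Fin L)) (i : Fin L)
    (hi : i ∉ S) (a : ℕ) (ha : a ≤ N i) :
    muH (muAgree (fun i' _ => i' ∈ S) : Setoid (MULibrary L N F)) + a * (F * Real.log 2) ≤
    muH (muAgree (fun i' f => i' ∈ S ∨ (i' = i ∧ (f : ℕ) < a)) : Setoid (MULibrary L N F)) := by
  rw [muH_agree, muH_agree]
  have e : ∀ i' : Fin L, (∑ f : Fin (N i'),
      @ite ℝ (i' ∈ S ∨ (i' = i ∧ (f : ℕ) < a)) (Classical.propDecidable _)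
        ((F : ℝ) * Real.log 2) 0) =
      (∑ f : Fin (N i'), @ite ℝ (i' ∈ S) (Classical.propDecidable _) ((F : ℝ) * Real.log 2) 0)
      + if i' = i then a * (F * Real.log 2) else 0 := by
    intro i'
    by_cases h : i' = i
    · subst h
      simp only [hi, false_or, true_and, if_false, if_true, Finset.sum_const_zero, zero_add]
      rw [Fin.sum_univ_eq_sum_range (fun f => if f < a then (F : ℝ) * Real.log 2 else 0),
        ← Finset.sum_filter]
      have : (range (N i' : ℕ)).filter (fun f => f < a) = range a := by
        ext f; simp; omega
      rw [this]; simp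
    · simp [h]
  rw [Finset.sum_congr rfl (fun i' _ => e i'), Finset.sum_add_distrib]
  simp

end Library

lemma mu_nonempty (L : ℕ) (N U : Fin L → ℕ+) (K : ℕ+) (M : ℝ) (hM : 0 ≤ M) :
    ∃ R, MUAchievable L N U K R M := by
  refine ⟨∑ i, (N i : ℕ), by positivity, hM, ?_⟩
  intro ε hε
  let e := Fintype.equivFin (MULibrary L N ((1 : ℕ+) : ℕ))
  refine ⟨1, 1, Fintype.card (MULibrary L N ((1 : ℕ+) : ℕ)), fun _ _ => 0, fun _ w => e w,
    fun i k u d x _ => e.symm x i (d i k u), ?_, ?_, ?_⟩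
  · rw [Nat.cast_one]
    exact Real.one_le_rpow (by norm_num) (by positivity)
  · rw [muCard_lib]
    have : ((∏ i : Fin L, ∏ _f : Fin (N i), 2 ^ ((1 : ℕ+) : ℕ) : ℕ) : ℝ)
        = (2 : ℝ) ^ ((∑ i, ((N i : ℕ) : ℝ)) : ℝ) := by
      rw [← Nat.cast_sum, Real.rpow_natCast]
      simp [Finset.prod_pow_eq_pow_sum]
    rw [this]
    apply Real.rpow_le_rpow_of_exponent_le (by norm_num)
    simp
    exact hε.le
  · intro w d i k u
    exact congrFun (congrFun (e.symm_apply_apply w) i) _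

lemma mu_bound (L : ℕ) (N U : Fin L → ℕ+) (K : ℕ+) (M R : ℝ)
    (b : ℕ+) (t : ℕ) (ht1 : 1 ≤ t) (hfloor : 1 ≤ (K : ℕ) / (2 * t))
    (s : Fin L → ℕ) (hs : ∀ i, 1 ≤ s i ∧ s i ≤ (K : ℕ) / (2 * t))
    (F : ℕ+) (zsize xsize : ℕ)
    (Z : Fin K → MULibrary L N F → Fin zsize)
    (X : MUDemand L N U K → MULibrary L N F → Fin xsize)
    (dec : (i : Fin L) → Fin K → Fin (U i) → MUDemand L N U K →
        Fin xsize → Fin zsize → (Fin F → Bool))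
    (hz : (zsize : ℝ) ≤ (2 : ℝ) ^ (M * (F : ℝ)))
    (hx : (xsize : ℝ) ≤ (2 : ℝ) ^ (R * (F : ℝ)))
    (hdec : ∀ (w : MULibrary L N F) (d : MUDemand L N U K)
        (i : Fin L) (k : Fin K) (u : Fin (U i)),
        dec i k u d (X d w) (Z k w) = w i (d i k u)) :
    ∑ i, (min (s i * s i * t * b * (U i : ℕ)) (N i : ℕ) : ℕ) / (s i : ℝ) ≤ t * M + b * R := by
  classical
  set n := (K : ℕ) / t with hn
  have hsn : ∀ i, 2 * s i ≤ n := by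
    intro i
    have := (hs i).2
    rw [mul_comm 2 t, ← Nat.div_div_eq_div_mul, ← hn] at this
    omega
  have hn0 : 0 < n := by
    rw [mul_comm 2 t, ← Nat.div_div_eq_div_mul, ← hn] at hfloor
    omega
  have hnK : n * t ≤ K := Nat.div_mul_le_self _ _
  have hcache : ∀ j τ : ℕ, τ < t → (j % n) * t + τ < K := by
    intro j τ hτ
    have := Nat.mod_lt j hn0
    nlinarith
  let m := n * ∏ i, s i
  have hm0 : 0 < m := Nat.mul_pos hn0 (Finset.prod_pos fun i _ => (hs i).1)
  have hnm : n ∣ m := Dvd.intro _ rfl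
  have hsm : ∀ i, s i ∣ m := fun i => (Finset.dvd_prod_of_mem s (Finset.mem_univ i)).mul_left n
  let D : ℕ → ℕ → MUDemand L N U K := fun j β i k u =>
    ⟨muIdx (s i) t b (U i) (j % s i) (muLift n (s i) j ((k : ℕ) / t)) ((k : ℕ) % t) β u % (N i : ℕ),
      Nat.mod_lt _ (N i).pos⟩
  have hD : ∀ j β, D (j + m) β = D j β := by
    intro j β
    funext i k u
    apply Fin.ext
    simp only [D]
    rw [muLift_periodic n (s i) j _ m hnm (hsm i)]
    obtain ⟨r, hr⟩ := hsm i
    rw [hr, Nat.add_mul_mod_self_left]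
  let y : ℕ → MULibrary L N F → (Fin t → Fin zsize) × (Fin b → Fin xsize) := fun j w =>
    (fun τ => Z ⟨(j % n) * t + τ, hcache j τ τ.2⟩ w, fun β => X (D j β) w)
  let Y : ℕ → Setoid (MULibrary L N F) := fun j => Setoid.ker (y j)
  have hY : ∀ j, Y (j + m) = Y j := by
    intro j
    have : y (j + m) = y j := by
      funext w
      simp only [y, hD]
      have e : (j + m) % n = j % n := by
        obtain ⟨r, hr⟩ := hnm
        rw [hr, Nat.add_mul_mod_self_left]
      simp only [e]
    simp only [Y, this]
  let V : Finset (Fin L) → Setoid (MULibrary L N F) := fun S => muAgree (fun i' _ => i' ∈ S)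
  let a : Fin L → ℕ := fun i => min (s i * s i * t * b * (U i : ℕ)) (N i : ℕ)
  -- decoding
  have hdecode : ∀ (i : Fin L) (p : ℕ) (w w' : MULibrary L N F), muWin Y p (s i) w w' →
      ∀ f : Fin (N i), (f : ℕ) < a i → w i f = w' i f := by
    intro i p w w' hw f hf
    obtain ⟨x, y', τ, β, u, hx, hy, hτ, hβ, hu, hidx⟩ :=
      muIdx_surj (s i) t b (U i) f (lt_of_lt_of_le hf (min_le_left _ _))
    obtain ⟨j, hj1, hj2, hj3⟩ := mu_window_residue p (s i) x hx
    obtain ⟨j', hj1', hj2', hj3'⟩ := mu_window_residue p (s i) y' hy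
    have hd : D j β i ⟨(j' % n) * t + τ, hcache j' τ hτ⟩ ⟨u, hu⟩ = f := by
      apply Fin.ext
      simp only [D]
      rw [show (j' % n * t + τ) / t = j' % n by
          rw [mul_comm, Nat.mul_add_div (by omega), Nat.div_eq_of_lt hτ, add_zero],
        show (j' % n * t + τ) % t = τ by
          rw [mul_comm, Nat.mul_add_mod, Nat.mod_eq_of_lt hτ],
        muLift_spec n (s i) j j' (hs i).1 (hsn i) (by omega) (by omega), hj3, hj3', hidx,
        Nat.mod_eq_of_lt f.2]
    have h1 : y j w = y j w' := hw j hj1 hj2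
    have h2 : y j' w = y j' w' := hw j' hj1' hj2'
    have hX : X (D j β) w = X (D j β) w' := congrFun (congrArg Prod.snd h1) ⟨β, hβ⟩
    have hZ : Z ⟨(j' % n) * t + τ, hcache j' τ hτ⟩ w = Z ⟨(j' % n) * t + τ, hcache j' τ hτ⟩ w' :=
      congrFun (congrArg Prod.fst h2) ⟨τ, hτ⟩
    have e1 := hdec w (D j β) i ⟨(j' % n) * t + τ, hcache j' τ hτ⟩ ⟨u, hu⟩
    have e2 := hdec w' (D j β) i ⟨(j' % n) * t + τ, hcache j' τ hτ⟩ ⟨u, hu⟩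
    rw [hd] at e1 e2
    rw [← e1, ← e2, hX, hZ]
  have hchain := mu_chain Y m hY V s (fun i => (hs i).1)
    (fun i => m * (a i * ((F : ℕ) * Real.log 2))) (by
      intro S i hi
      apply mu_step Y m (V S) (V (insert i S))
        (muAgree (fun i' f => i' ∈ S ∨ (i' = i ∧ (f : ℕ) < a i))) (s i)
      · intro w w' h i' f h'
        exact h i' f (Finset.mem_insert_of_mem h')
      · intro w w' h i' f h'
        apply h i' f
        rcases h' with h' | ⟨rfl, -⟩
        · exact Finset.mem_insert_of_mem h'
        · exact Finset.mem_insert_self _ _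
      · rintro p w w' ⟨h1, h2⟩ i' f h'
        rcases h' with h' | ⟨rfl, h'⟩
        · exact h2 i' f h'
        · exact hdecode i' p w w' h1 f h'
      · exact muH_agree_level S i hi (a i) (min_le_right _ _))
  have hl2 : 0 < Real.log 2 := Real.log_pos (by norm_num)
  have hF : (0 : ℝ) < ((F : ℕ) : ℝ) := by exact_mod_cast F.pos
  have hm : (0 : ℝ) < m := by exact_mod_cast hm0
  -- upper bound
  have hV0 : muH (V ∅) = 0 := by simp [V, muH_agree]
  let w0 : MULibrary L N F := fun _ _ _ => false
  have hzp : 0 < (zsize : ℝ) := by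
    have := Fin.pos (Z ⟨0, K.pos⟩ w0)
    exact_mod_cast this
  have hxp : 0 < (xsize : ℝ) := by
    have := Fin.pos (X (D 0 0) w0)
    exact_mod_cast this
  have lz : Real.log zsize ≤ M * (F : ℕ) * Real.log 2 := by
    have := Real.log_le_log hzp hz
    rwa [Real.log_rpow (by norm_num)] at this
  have lx : Real.log xsize ≤ R * (F : ℕ) * Real.log 2 := by
    have := Real.log_le_log hxp hx
    rwa [Real.log_rpow (by norm_num)] at this
  have hup : muE Y m (V ∅) 1 ≤ m * ((t * M + b * R) * ((F : ℕ) * Real.log 2)) := by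
    unfold muE
    have each : ∀ p ∈ Finset.range m, muH (muWin Y p 1 ⊓ V ∅) - muH (V ∅) ≤
        (t * M + b * R) * ((F : ℕ) * Real.log 2) := by
      intro p _
      rw [hV0, sub_zero]
      have e1 : muH (muWin Y p 1 ⊓ V ∅) ≤ muH (Y p) := by
        apply muH_anti
        intro w w' h
        refine ⟨fun j h1 h2 => ?_, fun i f h' => absurd h' (Finset.notMem_empty _)⟩
        obtain rfl : j = p := by omega
        exact h
      have e2 := muH_ker_le (y p)
      rw [Fintype.card_prod, Fintype.card_fun, Fintype.card_fun] at e2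
      simp only [Fintype.card_fin] at e2
      push_cast at e2
      rw [Real.log_mul (by positivity) (by positivity), Real.log_pow, Real.log_pow] at e2
      have e3 := mul_le_mul_of_nonneg_left lz (Nat.cast_nonneg (α := ℝ) t)
      have e4 := mul_le_mul_of_nonneg_left lx (Nat.cast_nonneg (α := ℝ) (b : ℕ))
      have e5 : muH (Y p) ≤ _ := e2
      linarith
    have := Finset.sum_le_sum each
    simpa using this
  have hfin := hchain.trans hup
  have e : ∑ i, (m : ℝ) * (a i * ((F : ℕ) * Real.log 2)) / (s i : ℝ)
      = (∑ i, (a i : ℝ) / (s i : ℝ)) * (m * ((F : ℕ) * Real.log 2)) := by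
    rw [Finset.sum_mul]
    refine Finset.sum_congr rfl fun i _ => by ring
  rw [e] at hfin
  have hpos : 0 < (m : ℝ) * ((F : ℕ) * Real.log 2) := by positivity
  exact le_of_mul_le_mul_right (by linarith) hpos


/-- Non-cut-set lower bound for the multi-user setup: for every `b ∈ ℕ+`,
`t ∈ {1, …, K}` and `s i ∈ {1, …, ⌊K/(2t)⌋}` (assuming `⌊K/(2t)⌋ ≥ 1`),
`R*(M) ≥ ∑_i min{ s_i·t·U_i , N_i/(s_i·b) } − (t/b)·M`. -/
theorem mu_sliding_window_lower_bound (L : ℕ) (N U : Fin L → ℕ+) (K : ℕ+)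
    (M : ℝ) (hM : 0 ≤ M)
    (b : ℕ+) (t : ℕ) (ht1 : 1 ≤ t) (htK : t ≤ (K : ℕ))
    (hfloor : 1 ≤ (K : ℕ) / (2 * t))
    (s : Fin L → ℕ) (hs : ∀ i, 1 ≤ s i ∧ s i ≤ (K : ℕ) / (2 * t)) :
    ∑ i, min ((s i : ℝ) * (t : ℝ) * ((U i : ℕ) : ℝ))
          (((N i : ℕ) : ℝ) / ((s i : ℝ) * ((b : ℕ) : ℝ)))
      - ((t : ℝ) / ((b : ℕ) : ℝ)) * M
      ≤ RstarMU L N U K M := by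
  apply le_csInf (mu_nonempty L N U K M hM)
  rintro R ⟨_, _, hR⟩
  apply le_of_forall_pos_le_add
  intro ε hε
  obtain ⟨F, zsize, xsize, Z, X, dec, hz, hx, hdec⟩ := hR ε hε
  have h := mu_bound L N U K M (R + ε) b t ht1 hfloor s hs F zsize xsize Z X dec hz hx hdec
  have hb : (0 : ℝ) < ((b : ℕ) : ℝ) := by exact_mod_cast b.pos
  have e : ∑ i, min ((s i : ℝ) * (t : ℝ) * ((U i : ℕ) : ℝ))
          (((N i : ℕ) : ℝ) / ((s i : ℝ) * ((b : ℕ) : ℝ)))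
      = (∑ i, (min (s i * s i * t * b * (U i : ℕ)) (N i : ℕ) : ℕ) / (s i : ℝ)) / ((b : ℕ) : ℝ) := by
    rw [Finset.sum_div]
    refine Finset.sum_congr rfl fun i _ => ?_
    have hsi : (0 : ℝ) < s i := by exact_mod_cast (hs i).1
    rw [div_div]
    push_cast
    rw [← min_div_div_right (by positivity)]
    congr 1
    field_simp
  rw [e]
  have h2 := div_le_div_of_nonneg_right h hb.le
  have e2 : ((t : ℝ) * M + (b : ℕ) * (R + ε)) / ((b : ℕ) : ℝ) = t / (b : ℕ) * M + (R + ε) := by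
    field_simp
  rw [e2] at h2
  linarith
end

section
/- Consider the single-user coded caching model with L levels, where level i has N_i ∈ ℕ+ files and K_i ∈ ℕ+ users, with N_i ≥ K_i for every i. For every memory M ≥ 0, define H' = {h ∈ {1,…,L} : M < N_h/K_h} and I' = {1,…,L} ∖ H'. Then the pair (R^SU(M), M) is achievable, where R^SU(M) = Σ_{h∈H'} K_h + max{ (Σ_{i∈I'} N_i)/M − 1 , 0 } (the second term being 0 when I' is empty). -/
/-- A library: each level `i` has `N i` files, and each file is an arbitrary
element of `{0,1}^F`. -/
def SULibrary (L : ℕ) (N : Fin L → ℕ+) (F : ℕ) : Type :=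
  (i : Fin L) → Fin (N i) → Fin F → Bool

/-- A demand vector of the single-user setup: there are `K = K_1 + ⋯ + K_L` caches,
each with a single user attached, and each user demands a level together with a file
index of that level. -/
def SUDemand (L : ℕ) (N Kl : Fin L → ℕ+) : Type :=
  Fin (∑ i, (Kl i : ℕ)) → (i : Fin L) × Fin (N i)

/-- A demand vector is valid if, for each level `i`, exactly `K i` of the users
demand a file of level `i`. -/
def SUValidDemand (L : ℕ) (N Kl : Fin L → ℕ+) (d : SUDemand L N Kl) : Prop :=
  ∀ i : Fin L, (Finset.univ.filter fun k => (d k).1 = i).card = (Kl i : ℕ)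

/-- The pair `(R, M)` is achievable in the single-user multi-level coded caching model
with `L` levels, `N i` files and `K i` users for level `i`: `R, M ≥ 0` and, for every
`ε > 0`, there are a file size `F` and a scheme consisting of placement maps `Z k` into
a set of cardinality at most `2^(M·F)`, encoding maps `X d` into a set of cardinality
at most `2^((R+ε)·F)`, and decoding maps, such that every user correctly recovers its
demanded file for every library and every valid demand vector. -/
def SUAchievable (L : ℕ) (N Kl : Fin L → ℕ+) (R M : ℝ) : Prop :=
  0 ≤ R ∧ 0 ≤ M ∧
  ∀ ε : ℝ, 0 < ε →
    ∃ (F : ℕ+) (zsize xsize : ℕ)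
      (Z : Fin (∑ i, (Kl i : ℕ)) → SULibrary L N F → Fin zsize)
      (X : SUDemand L N Kl → SULibrary L N F → Fin xsize)
      (dec : Fin (∑ i, (Kl i : ℕ)) → SUDemand L N Kl →
        Fin xsize → Fin zsize → (Fin F → Bool)),
      (zsize : ℝ) ≤ (2 : ℝ) ^ (M * (F : ℝ)) ∧
      (xsize : ℝ) ≤ (2 : ℝ) ^ ((R + ε) * (F : ℝ)) ∧
      ∀ (w : SULibrary L N F) (d : SUDemand L N Kl), SUValidDemand L N Kl d →
        ∀ k, dec k d (X d w) (Z k w) = w (d k).1 (d k).2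

/-- `R*(M)`: the optimal rate of the single-user setup,
i.e. the infimum of the rates `R` such that `(R, M)` is achievable. -/
noncomputable def RstarSU (L : ℕ) (N Kl : Fin L → ℕ+) (M : ℝ) : ℝ :=
  sInf {R | SUAchievable L N Kl R M}

open scoped Classical in
/-- The clustering rate of the single-user setup:
`R^SU(M) = ∑_{h ∈ H'} K_h + max{(∑_{i ∈ I'} N_i)/M − 1, 0}`, where
`H' = {h : M < N_h/K_h}` and `I'` is its complement. -/
noncomputable def RSU (L : ℕ) (N Kl : Fin L → ℕ+) (M : ℝ) : ℝ :=
  ∑ h ∈ Finset.univ.filter (fun h : Fin L => M < ((N h : ℕ) : ℝ) / ((Kl h : ℕ) : ℝ)),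
      ((Kl h : ℕ) : ℝ)
  + max ((∑ i ∈ Finset.univ.filter
        (fun i : Fin L => ¬ M < ((N i : ℕ) : ℝ) / ((Kl i : ℕ) : ℝ)),
        ((N i : ℕ) : ℝ)) / M - 1) 0

open scoped Classical in
lemma su_generic {L : ℕ} {N Kl : Fin L → ℕ+} (F : ℕ+) (zsize xsize : ℕ)
    (hxpos : 0 < xsize)
    (Zt : Fin (∑ i, (Kl i : ℕ)) → Type) [∀ k, Fintype (Zt k)]
    (Xt : SUDemand L N Kl → Type) [∀ d, Fintype (Xt d)]
    (Z : ∀ k, SULibrary L N F → Zt k) (X : ∀ d, SULibrary L N F → Xt d)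
    (hz : ∀ k, Fintype.card (Zt k) ≤ zsize)
    (hx : ∀ d, SUValidDemand L N Kl d → Fintype.card (Xt d) ≤ xsize)
    (hdec : ∀ d, SUValidDemand L N Kl d → ∀ k w w', X d w = X d w' → Z k w = Z k w' →
      w (d k).1 (d k).2 = w' (d k).1 (d k).2) :
    ∃ (Z : Fin (∑ i, (Kl i : ℕ)) → SULibrary L N F → Fin zsize)
      (X : SUDemand L N Kl → SULibrary L N F → Fin xsize)
      (dec : Fin (∑ i, (Kl i : ℕ)) → SUDemand L N Kl →
        Fin xsize → Fin zsize → (Fin F → Bool)),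
      ∀ (w : SULibrary L N F) (d : SUDemand L N Kl), SUValidDemand L N Kl d →
        ∀ k, dec k d (X d w) (Z k w) = w (d k).1 (d k).2 := by
  have hZ : ∀ k, ∃ f : Zt k → Fin zsize, Function.Injective f := fun k => by
    have : Nonempty (Zt k ↪ Fin zsize) :=
      Function.Embedding.nonempty_of_card_le (by simpa using hz k)
    exact ⟨this.some, this.some.injective⟩
  have hX : ∀ d, ∃ f : Xt d → Fin xsize, SUValidDemand L N Kl d → Function.Injective f :=
    fun d => by
    by_cases h : SUValidDemand L N Kl d
    · have : Nonempty (Xt d ↪ Fin xsize) :=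
        Function.Embedding.nonempty_of_card_le (by simpa using hx d h)
      exact ⟨this.some, fun _ => this.some.injective⟩
    · exact ⟨fun _ => ⟨0, hxpos⟩, fun h' => absurd h' h⟩
  choose fZ hfZ using hZ
  choose fX hfX using hX
  refine ⟨fun k w => fZ k (Z k w), fun d w => fX d (X d w), fun k d x z =>
    if h : ∃ w, fX d (X d w) = x ∧ fZ k (Z k w) = z then h.choose (d k).1 (d k).2
    else fun _ => false, ?_⟩
  intro w d hd k
  have h : ∃ w', fX d (X d w') = fX d (X d w) ∧ fZ k (Z k w') = fZ k (Z k w) := ⟨w, rfl, rfl⟩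
  simp only [dif_pos h]
  exact hdec d hd k _ _ (hfX d hd h.choose_spec.1) (hfZ k h.choose_spec.2)

def suSig {K : ℕ} {A B : Type} [AddCommGroup A] (z : Fin K → A ⊕ B) : A :=
  ∑ k, Sum.elim (fun a => a) (fun _ => 0) (z k)

lemma suSig_update {K : ℕ} {A B : Type} [AddCommGroup A] (x : Fin K → A ⊕ B) (k : Fin K)
    (b : B) (hb : x k = Sum.inr b) (a : A) :
    suSig (Function.update x k (Sum.inl a)) = a + suSig x := by
  unfold suSig
  rw [← Finset.add_sum_erase _ _ (Finset.mem_univ k),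
    ← Finset.add_sum_erase _ (fun j => Sum.elim (fun a => a) (fun _ => 0) (x j))
      (Finset.mem_univ k)]
  simp only [Function.update_self, Sum.elim_inl, hb, Sum.elim_inr, zero_add]
  congr 1
  refine Finset.sum_congr rfl fun j hj => ?_
  rw [Function.update_of_ne (Finset.ne_of_mem_erase hj)]

lemma su_pigeon {K : ℕ} {A B : Type} [AddCommGroup A] [Fintype A] [Fintype B] [DecidableEq A] :
    ∃ c : A, Fintype.card A * Fintype.card {z : Fin K → A ⊕ B // suSig z = c} ≤
      (Fintype.card A + Fintype.card B) ^ K := by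
  by_contra! h
  have h1 : ∑ c : A, Fintype.card {z : Fin K → A ⊕ B // suSig z = c} =
      (Fintype.card A + Fintype.card B) ^ K := by
    rw [← Fintype.card_sigma, Fintype.card_congr (Equiv.sigmaFiberEquiv suSig)]
    simp
  have h2 : ∑ c : A, (Fintype.card A + Fintype.card B) ^ K <
      ∑ c : A, Fintype.card A * Fintype.card {z : Fin K → A ⊕ B // suSig z = c} :=
    Finset.sum_lt_sum_of_nonempty ⟨0, Finset.mem_univ _⟩ fun c _ => h c
  rw [← Finset.mul_sum, h1] at h2
  simp at h2

lemma su_cacheCount {K : ℕ} {A B : Type} [Fintype A] [Fintype B] (k : Fin K) :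
    (Fintype.card A + Fintype.card B) * Fintype.card {x : Fin K → A ⊕ B // (x k).isLeft} =
      Fintype.card A * (Fintype.card A + Fintype.card B) ^ K := by
  classical
  have e : {x : Fin K → A ⊕ B // (x k).isLeft} ≃ {s : A ⊕ B // s.isLeft} × ({j // j ≠ k} → A ⊕ B) :=
    { toFun := fun x => (⟨x.1 k, x.2⟩, fun j => x.1 j)
      invFun := fun p => ⟨fun j => if h : j = k then p.1.1 else p.2 ⟨j, h⟩, by simpa using p.1.2⟩
      left_inv := fun x => by
        ext j
        by_cases h : j = k
        · subst h; simp
        · simp [h]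
      right_inv := fun p => by
        ext j
        · simp
        · simp [j.2] }
  have e2 : {s : A ⊕ B // s.isLeft} ≃ A :=
    { toFun := fun s => s.1.getLeft s.2
      invFun := fun a => ⟨Sum.inl a, rfl⟩
      left_inv := fun s => by simp
      right_inv := fun a => by simp }
  rw [Fintype.card_congr e, Fintype.card_prod, Fintype.card_congr e2]
  have hK : K = (K - 1) + 1 := by have := k.pos; omega
  have hc : Fintype.card {j // j ≠ k} = K - 1 := by simp
  rw [Fintype.card_fun, hc, Fintype.card_sum]
  conv_rhs => rw [hK]
  rw [pow_succ]
  ring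

def suBit (b : Bool) : ZMod 2 := if b then 1 else 0

lemma suBit_inj {a b : Bool} (h : suBit a = suBit b) : a = b := by
  revert h; revert a b; decide

open scoped Classical in
noncomputable def suMsg {L : ℕ} {N Kl : Fin L → ℕ+} {F : ℕ} (H : Fin L → Prop) {A B : Type}
    (e : (Fin (∑ i, (Kl i : ℕ)) → A ⊕ B) ≃ Fin F) (d : SUDemand L N Kl)
    (w : SULibrary L N F) (z : Fin (∑ i, (Kl i : ℕ)) → A ⊕ B) (b : B)
    (j : Fin (∑ i, (Kl i : ℕ))) : ZMod 2 :=
  if ¬ H (d j).1 ∧ (z j).isLeft then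
    suBit (w (d j).1 (d j).2 (e (Function.update z j (Sum.inr b)))) else 0

lemma su_decode {L : ℕ} {N Kl : Fin L → ℕ+} {F : ℕ} (H : Fin L → Prop) {A B : Type}
    [AddCommGroup A]
    (e : (Fin (∑ i, (Kl i : ℕ)) → A ⊕ B) ≃ Fin F) (d : SUDemand L N Kl)
    (w w' : SULibrary L N F) (c : A) (k : Fin (∑ i, (Kl i : ℕ)))
    (hH : H (d k).1 → w (d k).1 (d k).2 = w' (d k).1 (d k).2)
    (hX : ∀ z : Fin (∑ i, (Kl i : ℕ)) → A ⊕ B, suSig z = c → ∀ b : B,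
      ∑ j, suMsg H e d w z b j = ∑ j, suMsg H e d w' z b j)
    (hZ : ∀ i (f : Fin (N i)), ¬ H i → ∀ x, (x k).isLeft → w i f (e x) = w' i f (e x)) :
    w (d k).1 (d k).2 = w' (d k).1 (d k).2 := by
  by_cases hk : H (d k).1
  · exact hH hk
  funext p
  obtain ⟨x, rfl⟩ := e.surjective p
  rcases hxk : x k with a | b
  · exact hZ _ _ hk x (by simp [hxk])
  have h := hX (Function.update x k (Sum.inl (c - suSig x)))
    (by rw [suSig_update x k b hxk]; abel) b
  rw [← Finset.add_sum_erase _ _ (Finset.mem_univ k),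
    ← Finset.add_sum_erase _ (suMsg H e d w' _ b) (Finset.mem_univ k)] at h
  have h2 : ∀ j ∈ Finset.univ.erase k,
      suMsg H e d w (Function.update x k (Sum.inl (c - suSig x))) b j =
      suMsg H e d w' (Function.update x k (Sum.inl (c - suSig x))) b j := by
    intro j hj
    have hne := Finset.ne_of_mem_erase hj
    unfold suMsg
    split_ifs with hc
    · rw [hZ _ _ hc.1]
      rw [Function.update_of_ne hne.symm]
      simp
    · rfl
  rw [Finset.sum_congr rfl h2] at h
  have h3 := add_right_cancel h
  unfold suMsg at h3
  have hxx : Function.update x k (Sum.inr b) = x := by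
    rw [← hxk]; simp
  simp only [hk, Function.update_self, Sum.isLeft_inl, not_false_eq_true, and_self, if_true,
    Function.update_idem, hxx] at h3
  exact suBit_inj h3

lemma su_hcount {L : ℕ} {N Kl : Fin L → ℕ+} (H : Fin L → Prop) [DecidablePred H]
    (d : SUDemand L N Kl) (hd : SUValidDemand L N Kl d) :
    Fintype.card {j // H (d j).1} = ∑ h ∈ Finset.univ.filter H, (Kl h : ℕ) := by
  rw [Fintype.card_subtype,
    Finset.card_eq_sum_card_fiberwise (f := fun j => (d j).1) (t := Finset.univ.filter H)
      (fun j hj => by simpa using hj)]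
  refine Finset.sum_congr rfl fun i hi => ?_
  rw [← hd i]
  congr 1
  ext j
  simp only [Finset.mem_filter, Finset.mem_univ, true_and] at hi ⊢
  constructor
  · exact fun h => h.2
  · exact fun h => ⟨h ▸ hi, h⟩

lemma su_fcount {L : ℕ} {N : Fin L → ℕ+} (H : Fin L → Prop) [DecidablePred H] :
    Fintype.card {p : (i : Fin L) × Fin (N i) // ¬ H p.1} =
      ∑ i ∈ Finset.univ.filter (fun i => ¬ H i), (N i : ℕ) := by
  rw [Fintype.card_subtype,
    Finset.card_eq_sum_card_fiberwise (f := fun p => p.1) (t := Finset.univ.filter fun i => ¬ H i)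
      (fun j hj => by simpa using hj)]
  refine Finset.sum_congr rfl fun i hi => ?_
  have : (Finset.univ.filter fun p : (i : Fin L) × Fin (N i) => ¬ H p.1).filter (fun p => p.1 = i)
      = Finset.univ.map (Function.Embedding.sigmaMk i) := by
    ext ⟨j, f⟩
    simp only [Finset.mem_filter, Finset.mem_univ, true_and, Finset.mem_map] at hi ⊢
    constructor
    · rintro ⟨h, rfl⟩
      exact ⟨f, rfl⟩
    · rintro ⟨f', h⟩
      cases h
      exact ⟨hi, rfl⟩
  rw [this]
  simp

lemma su_params (S M ε : ℝ) (hε : 0 < ε) (hS : ¬ S ≤ M → 0 < M) :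
    ∃ m r : ℕ, 0 < m ∧ S * m ≤ M * (m + r) ∧ (r : ℝ) ≤ (max (S / M - 1) 0 + ε) * m := by
  by_cases h : S ≤ M
  · refine ⟨1, 0, one_pos, by simpa using h, ?_⟩
    have := le_max_right (S / M - 1) 0
    simp; linarith
  have hM' := hS h
  push Not at h
  obtain ⟨m, hm⟩ := exists_nat_gt (1 / ε)
  have hm0 : (0 : ℝ) < m := lt_trans (by positivity) hm
  have hy : 0 ≤ (S / M - 1) * m := by
    have : 1 < S / M := (one_lt_div hM').2 h
    exact mul_nonneg (by linarith) hm0.le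
  refine ⟨m, ⌈(S / M - 1) * m⌉₊, by exact_mod_cast hm0, ?_, ?_⟩
  · have h1 := Nat.le_ceil ((S / M - 1) * m)
    have h2 : S * m = M * (m + (S / M - 1) * m) := by field_simp; ring
    rw [h2]
    gcongr
  · have h1 := (Nat.ceil_lt_add_one hy).le
    have h2 : 1 ≤ ε * m := by
      rw [div_lt_iff₀ hε] at hm; linarith
    have h3 := mul_le_mul_of_nonneg_right (le_max_left (S / M - 1) 0) hm0.le
    linarith

/-- In the single-user setup with `N_i ≥ K_i` for every level, the pair
`(R^SU(M), M)` is achievable for every `M ≥ 0`. -/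
theorem clustering_rate_achievable (L : ℕ) (N Kl : Fin L → ℕ+)
    (hNK : ∀ i, (Kl i : ℕ) ≤ (N i : ℕ)) (M : ℝ) (hM : 0 ≤ M) :
    SUAchievable L N Kl (RSU L N Kl M) M := by
  classical
  refine ⟨?_, hM, ?_⟩
  · unfold RSU
    exact add_nonneg (Finset.sum_nonneg fun _ _ => by positivity) (le_max_right _ _)
  intro ε hε
  unfold RSU
  set H : Fin L → Prop := fun h => M < ((N h : ℕ) : ℝ) / ((Kl h : ℕ) : ℝ) with hHdef
  obtain ⟨m, r, hm, hcache, hrate⟩ := su_params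
    (∑ i ∈ Finset.univ.filter (fun i => ¬ H i), ((N i : ℕ) : ℝ)) M ε hε (by
      intro hS
      by_contra hM0
      have hM0' : M = 0 := le_antisymm (not_lt.1 hM0) hM
      apply hS
      rw [Finset.sum_eq_zero]
      · exact hM
      intro i hi
      exfalso
      apply (Finset.mem_filter.1 hi).2
      simp only [hHdef, hM0']
      have h1 := (N i).pos
      have h2 := (Kl i).pos
      positivity)
  obtain ⟨m, rfl⟩ : ∃ m', m = m' + 1 := ⟨m - 1, by omega⟩
  set K := ∑ i, (Kl i : ℕ) with hK
  let P := Fin K → Fin (m + 1) ⊕ Fin r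
  have hcardP : Fintype.card P = (m + 1 + r) ^ K := by simp [P]
  let F : ℕ+ := ⟨(m + 1 + r) ^ K, by positivity⟩
  have hF : ((F : ℕ) : ℝ) = ((m + 1 : ℕ) + r : ℝ) ^ K := by simp [F]
  let e : P ≃ Fin F := Fintype.equivFinOfCardEq hcardP
  obtain ⟨c, hc⟩ := su_pigeon (K := K) (A := Fin (m + 1)) (B := Fin r)
  have hF0 : (0 : ℝ) < (F : ℕ) := by exact_mod_cast F.pos
  set S := ∑ i ∈ Finset.univ.filter (fun i => ¬ H i), (N i : ℕ) with hS
  set T := ∑ h ∈ Finset.univ.filter H, (Kl h : ℕ) with hT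
  set nk := Fintype.card {z : Fin K → Fin (m + 1) ⊕ Fin r // suSig z = c} with hnk
  simp only [Fintype.card_fin] at hc
  have hKpos : ∀ k : Fin K, (m + 1 + r) * Fintype.card {x : P // (x k).isLeft} =
      (m + 1) * (m + 1 + r) ^ K := fun k => by
    simpa using su_cacheCount (A := Fin (m + 1)) (B := Fin r) k
  have hzreal : ∀ k : Fin K,
      ((S * Fintype.card {x : P // (x k).isLeft} : ℕ) : ℝ) ≤ M * (F : ℕ) := by
    intro k
    have h1 : (((m + 1 : ℕ) : ℝ) + r) * (Fintype.card {x : P // (x k).isLeft} : ℝ) =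
        ((m + 1 : ℕ) : ℝ) * (F : ℕ) := by
      rw [hF]; exact_mod_cast hKpos k
    have hq : (0 : ℝ) < ((m + 1 : ℕ) : ℝ) + r := by positivity
    rw [← Nat.cast_sum] at hcache
    rw [← mul_le_mul_iff_right₀ hq]
    push_cast at *
    calc _ = (S : ℝ) * (((m : ℝ) + 1 + r) * (Fintype.card {x : P // (x k).isLeft} : ℝ)) := by ring
      _ = (S * (m + 1)) * (F : ℕ) := by rw [h1]; ring
      _ ≤ (M * (m + 1 + r)) * (F : ℕ) := by
        refine mul_le_mul_of_nonneg_right ?_ hF0.le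
        rw [hS]
        push_cast
        exact hcache
      _ = _ := by ring
  have hxreal : ((T * (F : ℕ) + nk * r : ℕ) : ℝ) ≤
      (T + max ((S : ℝ) / M - 1) 0 + ε) * (F : ℕ) := by
    have h1 : ((m + 1 : ℕ) : ℝ) * nk ≤ (F : ℕ) := by
      rw [hF]; exact_mod_cast hc
    rw [← Nat.cast_sum] at hrate
    have hq : (0 : ℝ) < ((m + 1 : ℕ) : ℝ) := by positivity
    have h2 : (nk : ℝ) * r ≤ (max ((S : ℝ) / M - 1) 0 + ε) * (F : ℕ) := by
      have hpos : 0 ≤ max ((S : ℝ) / M - 1) 0 + ε :=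
        add_nonneg (le_max_right _ _) hε.le
      calc (nk : ℝ) * r ≤ nk * ((max ((S : ℝ) / M - 1) 0 + ε) * ((m + 1 : ℕ) : ℝ)) := by gcongr
        _ = (max ((S : ℝ) / M - 1) 0 + ε) * (((m + 1 : ℕ) : ℝ) * nk) := by ring
        _ ≤ _ := by gcongr
    push_cast at *
    linarith
  let Zt : Fin K → Type := fun k =>
    {p : (i : Fin L) × Fin (N i) // ¬ H p.1} × {x : P // (x k).isLeft} → Bool
  let Xt : SUDemand L N Kl → Type := fun d =>
    ({j // H (d j).1} → Fin F → Bool) ×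
      ({z : Fin K → Fin (m + 1) ⊕ Fin r // suSig z = c} × Fin r → ZMod 2)
  letI iZ : ∀ k, Fintype (Zt k) := fun k => inferInstanceAs (Fintype
    ({p : (i : Fin L) × Fin (N i) // ¬ H p.1} × {x : P // (x k).isLeft} → Bool))
  letI iX : ∀ d, Fintype (Xt d) := fun d => inferInstanceAs (Fintype
    (({j // H (d j).1} → Fin F → Bool) ×
      ({z : Fin K → Fin (m + 1) ⊕ Fin r // suSig z = c} × Fin r → ZMod 2)))
  obtain ⟨Z, X, dec, h⟩ := su_generic (L := L) (N := N) (Kl := Kl) F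
    ⌊(2 : ℝ) ^ (M * (F : ℕ))⌋₊ (2 ^ (T * (F : ℕ) + nk * r)) (by positivity) Zt Xt
    (fun k w p => w p.1.1.1 p.1.1.2 (e p.2.1))
    (fun d w => (fun j => w (d j.1).1 (d j.1).2,
      fun p => ∑ j, suMsg H e d w p.1.1 p.2 j))
    (by
      intro k
      apply Nat.le_floor
      have hcard : Fintype.card (Zt k) = 2 ^ (S * Fintype.card {x : P // (x k).isLeft}) := by
        change Fintype.card
          ({p : (i : Fin L) × Fin (N i) // ¬ H p.1} × {x : P // (x k).isLeft} → Bool) = _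
        rw [Fintype.card_fun, Fintype.card_prod, su_fcount, Fintype.card_bool]
      rw [hcard]
      push_cast
      rw [← Real.rpow_natCast]
      exact Real.rpow_le_rpow_of_exponent_le one_le_two (hzreal k))
    (by
      intro d hd
      have hcard : Fintype.card (Xt d) = 2 ^ (T * (F : ℕ) + nk * r) := by
        change Fintype.card (({j // H (d j).1} → Fin F → Bool) ×
          ({z : Fin K → Fin (m + 1) ⊕ Fin r // suSig z = c} × Fin r → ZMod 2)) = _
        rw [Fintype.card_prod, Fintype.card_fun, Fintype.card_fun, Fintype.card_fun,
          Fintype.card_prod, su_hcount H d hd, Fintype.card_bool, ZMod.card, Fintype.card_fin,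
          Fintype.card_fin, ← pow_mul, ← pow_add, mul_comm (F : ℕ)]
      exact hcard.le)
    (by
      intro d hd k w w' hX hZ
      have hX1 := congrArg Prod.fst hX
      have hX2 := congrArg Prod.snd hX
      refine su_decode H e d w w' c k ?_ ?_ ?_
      · intro hk
        exact congrFun hX1 ⟨k, hk⟩
      · intro z hz b
        exact congrFun hX2 (⟨z, hz⟩, b)
      · intro i f hi x hx
        exact congrFun hZ (⟨⟨i, f⟩, hi⟩, ⟨x, hx⟩))
  refine ⟨F, _, _, Z, X, dec, Nat.floor_le (by positivity), ?_, h⟩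
  push_cast
  rw [← Real.rpow_natCast]
  refine Real.rpow_le_rpow_of_exponent_le one_le_two (hxreal.trans (le_of_eq ?_))
  rw [hS, hT]
  push_cast
  rfl
end
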